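/- For every positive integer n, t(1,1,4,8;n) = 2·(−1)^n · Σ_{d | 4n+7, d>0} d·(2/d) − (1 − (−1)^n) · Σ x, where (2/d) is the Jacobi symbol and the sum Σ x is over all pairs (x,y) of integers with x ≡ 1 (mod 4) and 4n+7 = x^2 + 2y^2. -/

import Mathlib

/-- `N a b c d n` : number of integer quadruples `(x,y,z,w)` with
`n = a*x^2 + b*y^2 + c*z^2 + d*w^2`. -/
noncomputable def N (a b c d : ℕ) (n : ℕ) : ℕ :=
  Set.ncard {P : ℤ × ℤ × ℤ × ℤ |
    (n : ℤ) = a * P.1 ^ 2 + b * P.2.1 ^ 2 + c * P.2.2.1 ^ 2 + d * P.2.2.2 ^ 2}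

/-- `t a b c d n` : number of integer quadruples `(x,y,z,w)` with
`n = a*x(x-1)/2 + b*y(y-1)/2 + c*z(z-1)/2 + d*w(w-1)/2`. -/
noncomputable def t (a b c d : ℕ) (n : ℕ) : ℕ :=
  Set.ncard {P : ℤ × ℤ × ℤ × ℤ |
    (n : ℤ) = a * (P.1 * (P.1 - 1) / 2) + b * (P.2.1 * (P.2.1 - 1) / 2)
      + c * (P.2.2.1 * (P.2.2.1 - 1) / 2) + d * (P.2.2.2 * (P.2.2.2 - 1) / 2)}


section gf
open PowerSeries (coeff)

def FF {α : Type} (q : α → ℕ) : Prop := ∀ n, {a | q a = n}.Finite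

noncomputable def G {α : Type} (q : α → ℕ) (w : α → ℤ) : PowerSeries ℤ :=
  PowerSeries.mk fun n => ∑ᶠ a ∈ {a | q a = n}, w a

lemma coeff_G {α : Type} (q : α → ℕ) (w : α → ℤ) (n : ℕ) :
    coeff n (G q w) = ∑ᶠ a ∈ {a | q a = n}, w a := by
  simp [G]

lemma FF.prod {α β : Type} {q : α → ℕ} {q' : β → ℕ} (h : FF q) (h' : FF q') :
    FF (fun p : α × β => q p.1 + q' p.2) := by
  intro n
  have : {p : α × β | q p.1 + q' p.2 = n} ⊆
      ((⋃ i ∈ Finset.range (n+1), {a | q a = i}) ×ˢ (⋃ i ∈ Finset.range (n+1), {a | q' a = i})) := by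
    rintro ⟨a, b⟩ hab
    simp at hab ⊢
    omega
  refine Set.Finite.subset (Set.Finite.prod ?_ ?_) this
  · exact Set.Finite.biUnion (Finset.finite_toSet _) (fun i _ => h i)
  · exact Set.Finite.biUnion (Finset.finite_toSet _) (fun i _ => h' i)

lemma G_mul {α β : Type} {q : α → ℕ} {q' : β → ℕ} (h : FF q) (h' : FF q') (w : α → ℤ) (w' : β → ℤ) :
    G q w * G q' w' = G (fun p : α × β => q p.1 + q' p.2) (fun p => w p.1 * w' p.2) := by
  classical
  ext n
  rw [PowerSeries.coeff_mul, coeff_G, finsum_mem_eq_finite_toFinset_sum _ (h.prod h' n)]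
  have : (h.prod h' n).toFinset = (Finset.HasAntidiagonal.antidiagonal n).biUnion
      (fun ij => (h ij.1).toFinset ×ˢ (h' ij.2).toFinset) := by
    ext ⟨a, b⟩
    simp
  rw [this, Finset.sum_biUnion]
  · refine Finset.sum_congr rfl fun ij _ => ?_
    rw [coeff_G, coeff_G, finsum_mem_eq_finite_toFinset_sum _ (h _),
      finsum_mem_eq_finite_toFinset_sum _ (h' _), Finset.sum_mul_sum, Finset.sum_product]
  · rintro ⟨i, j⟩ _ ⟨i', j'⟩ _ hne
    rw [Function.onFun, Finset.disjoint_left]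
    rintro ⟨a, b⟩ h1 h2
    simp at h1 h2
    apply hne
    rw [← h1.1, ← h1.2, h2.1, h2.2]

lemma G_equiv {α β : Type} {q : α → ℕ} {q' : β → ℕ} {w : α → ℤ} {w' : β → ℤ} (e : α ≃ β)
    (hq : ∀ a, q a = q' (e a)) (hw : ∀ a, w a = w' (e a)) : G q w = G q' w' := by
  ext n
  rw [coeff_G, coeff_G]
  refine finsum_mem_eq_of_bijOn e ?_ (fun a _ => hw a)
  refine ⟨fun a ha => ?_, e.injective.injOn, fun b hb => ⟨e.symm b, ?_, by simp⟩⟩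
  · simp only [Set.mem_ofPred_eq] at ha ⊢
    rw [← hq, ha]
  · simp only [Set.mem_ofPred_eq] at hb ⊢
    rw [hq]; simpa using hb

lemma coeff_G_zero {α : Type} {q : α → ℕ} {w : α → ℤ} {n : ℕ} (h : ∀ a, q a ≠ n) :
    coeff n (G q w) = 0 := by
  rw [coeff_G]
  have : {a | q a = n} = ∅ := by ext a; simpa using h a
  rw [this]; simp

lemma G_sum {α β : Type} {q : α → ℕ} {q' : β → ℕ} (h : FF q) (h' : FF q') (w : α → ℤ) (w' : β → ℤ) :
    G q w + G q' w' = G (Sum.elim q q') (Sum.elim w w') := by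
  classical
  ext n
  rw [map_add, coeff_G, coeff_G, coeff_G]
  have : {a | Sum.elim q q' a = n} = Sum.inl '' {a | q a = n} ∪ Sum.inr '' {a | q' a = n} := by
    ext (a | a) <;> simp
  rw [this, finsum_mem_union, finsum_mem_image Sum.inl_injective.injOn,
    finsum_mem_image Sum.inr_injective.injOn]
  · simp
  · rw [Set.disjoint_left]; rintro x ⟨a, _, rfl⟩ ⟨b, _, hb⟩; simp at hb
  · exact (h n).image _
  · exact (h' n).image _

lemma coeff_G_scale {α : Type} (q : α → ℕ) (w : α → ℤ) (c n : ℕ) (hc : 0 < c) :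
    coeff (c * n) (G (fun a => c * q a) w) = coeff n (G q w) := by
  rw [coeff_G, coeff_G]
  congr 1
  ext a
  simp [hc.ne']

lemma G_smul {α : Type} (q : α → ℕ) (w : α → ℤ) (c : ℤ) (h : FF q) :
    G q (fun a => c * w a) = (c : PowerSeries ℤ) * G q w := by
  ext n
  have hc : (c : PowerSeries ℤ) = PowerSeries.C c := by simp
  rw [coeff_G, hc, PowerSeries.coeff_C_mul, coeff_G,
    finsum_mem_eq_finite_toFinset_sum _ (h _), finsum_mem_eq_finite_toFinset_sum _ (h _),
    Finset.mul_sum]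

def qs (k : ℕ) (x : ℤ) : ℕ := k * x.natAbs ^ 2

lemma qs_cast (k : ℕ) (x : ℤ) : ((qs k x : ℕ) : ℤ) = k * x ^ 2 := by
  simp [qs]

lemma FF_of_le (q : ℤ → ℕ) (h : ∀ x, x.natAbs ≤ q x) : FF q := by
  intro n
  refine Set.Finite.subset (Set.finite_Icc (-(n:ℤ)) n) ?_
  rintro x hx
  have h1 : q x = n := hx
  have h2 := h x
  simp only [Set.mem_Icc]
  omega

lemma qs_FF (k : ℕ) (hk : 0 < k) : FF (qs k) := by
  apply FF_of_le
  intro x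
  unfold qs
  nlinarith [Nat.le_self_pow (n := 2) (by norm_num) x.natAbs]

lemma qso_FF (k : ℕ) (hk : 0 < k) : FF (fun x => qs k (2 * x + 1)) := by
  apply FF_of_le
  intro x
  unfold qs
  have : x.natAbs ≤ (2 * x + 1).natAbs := by omega
  nlinarith [Nat.le_self_pow (n := 2) (by norm_num) (2*x+1).natAbs]

noncomputable def th (k : ℕ) : PowerSeries ℤ := G (qs k) (fun _ => 1)
noncomputable def tho (k : ℕ) : PowerSeries ℤ := G (fun x => qs k (2 * x + 1)) (fun _ => 1)
noncomputable def ths (k : ℕ) : PowerSeries ℤ := G (qs k) (fun x => if x % 2 = 0 then 1 else -1)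

def evodd : ℤ ⊕ ℤ ≃ ℤ where
  toFun := Sum.elim (fun x => 2 * x + 1) (fun x => 2 * x)
  invFun x := if x % 2 = 0 then Sum.inr (x / 2) else Sum.inl (x / 2)
  left_inv := by
    rintro (x | x)
    · have : (2 * x + 1) % 2 ≠ 0 := by omega
      simp [this]; omega
    · simp
  right_inv := by
    intro x
    by_cases h : x % 2 = 0
    · simp [h]; omega
    · simp [h]; omega

lemma th_split (k : ℕ) (hk : 0 < k) : th k = tho k + th (4 * k) := by
  unfold th tho
  rw [G_sum (qso_FF k hk) (qs_FF _ (by omega))]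
  refine (G_equiv evodd ?_ ?_).symm
  · rintro (x | x)
    · simp [evodd]
    · zify; simp [evodd, qs_cast]; ring
  · rintro (x | x) <;> simp

lemma ths_split (k : ℕ) (hk : 0 < k) : ths k = - tho k + th (4 * k) := by
  have : - tho k = G (fun x => qs k (2 * x + 1)) (fun _ => -1) := by
    have := G_smul (fun x => qs k (2 * x + 1)) (fun _ => 1) (-1) (qso_FF k hk)
    simp at this
    rw [this, tho]
  rw [this]
  unfold ths th
  rw [G_sum (qso_FF k hk) (qs_FF _ (by omega))]
  refine (G_equiv evodd ?_ ?_).symm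
  · rintro (x | x)
    · simp [evodd]
    · zify; simp [evodd, qs_cast]; ring
  · rintro (x | x)
    · have : (2 * x + 1) % 2 ≠ 0 := by omega
      simp [evodd, this]
    · simp [evodd]

def eqA : (ℤ × ℤ) ⊕ (ℤ × ℤ) ≃ ℤ × ℤ where
  toFun := Sum.elim (fun p => (p.1 + p.2, p.1 - p.2)) (fun p => (p.1 + p.2, p.2 - p.1 - 1))
  invFun x := if (x.1 + x.2) % 2 = 0 then Sum.inl ((x.1 + x.2) / 2, (x.1 - x.2) / 2)
    else Sum.inr ((x.1 - x.2 - 1) / 2, (x.1 + x.2 + 1) / 2)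
  left_inv := by
    rintro (⟨a, e⟩ | ⟨a, e⟩)
    · have h : (a + e + (a - e)) % 2 = 0 := by omega
      simp only [Sum.elim_inl, h, if_true]
      congr 2 <;> omega
    · have h : ¬ (a + e + (e - a - 1)) % 2 = 0 := by omega
      simp only [Sum.elim_inr, h, if_false]
      congr 2 <;> omega
  right_inv := by
    rintro ⟨x, y⟩
    by_cases h : (x + y) % 2 = 0
    · simp only [h, if_true, Sum.elim_inl]
      ext <;> simp <;> omega
    · simp only [h, if_false, Sum.elim_inr]
      ext <;> simp <;> omega

lemma tho_sq (k : ℕ) (hk : 0 < k) : tho k * tho k = 2 * (tho (2 * k) * th (8 * k)) := by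
  unfold tho th
  have f1 := qso_FF k hk
  have f2 := (qso_FF (2 * k) (by omega)).prod (qs_FF (8 * k) (by omega))
  rw [G_mul f1 f1, G_mul (qso_FF (2 * k) (by omega)) (qs_FF (8 * k) (by omega)), two_mul,
    G_sum f2 f2]
  refine (G_equiv eqA ?_ ?_).symm
  · rintro (⟨x, y⟩ | ⟨x, y⟩)
    · zify; simp [eqA, qs_cast]; ring
    · zify; simp [eqA, qs_cast]; ring
  · rintro (⟨x, y⟩ | ⟨x, y⟩) <;> simp

def eqB : (ℤ × ℤ) ⊕ (ℤ × ℤ) ≃ ℤ × ℤ where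
  toFun := Sum.elim (fun p => (p.1 + p.2, p.1 - p.2)) (fun p => (p.1 + p.2 + 1, p.1 - p.2))
  invFun x := if (x.1 + x.2) % 2 = 0 then Sum.inl ((x.1 + x.2) / 2, (x.1 - x.2) / 2)
    else Sum.inr ((x.1 + x.2 - 1) / 2, (x.1 - x.2 - 1) / 2)
  left_inv := by
    rintro (⟨a, e⟩ | ⟨a, e⟩)
    · have h : (a + e + (a - e)) % 2 = 0 := by omega
      simp only [Sum.elim_inl, h, if_true]
      congr 2 <;> omega
    · have h : ¬ (a + e + 1 + (a - e)) % 2 = 0 := by omega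
      simp only [Sum.elim_inr, h, if_false]
      congr 2 <;> omega
  right_inv := by
    rintro ⟨x, y⟩
    by_cases h : (x + y) % 2 = 0
    · simp only [h, if_true, Sum.elim_inl]
      ext <;> simp <;> omega
    · simp only [h, if_false, Sum.elim_inr]
      ext <;> simp <;> omega

lemma th_sq (k : ℕ) (hk : 0 < k) :
    th (2 * k) * th (2 * k) = th (4 * k) * th (4 * k) + tho k * tho k := by
  unfold tho th
  have f1 := qs_FF (2 * k) (by omega)
  have f2 := qs_FF (4 * k) (by omega)
  have f3 := qso_FF k (by omega)
  rw [G_mul f1 f1, G_mul f2 f2, G_mul f3 f3, G_sum (f2.prod f2) (f3.prod f3)]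
  refine (G_equiv eqB ?_ ?_).symm
  · rintro (⟨x, y⟩ | ⟨x, y⟩)
    · zify; simp [eqB, qs_cast]; ring
    · zify; simp [eqB, qs_cast]; ring
  · rintro (⟨x, y⟩ | ⟨x, y⟩) <;> simp

lemma th_ths (k : ℕ) (hk : 0 < k) : th k * ths k = ths (2 * k) * ths (2 * k) := by
  have h1 := tho_sq k hk
  have h2 := th_sq (2 * k) (by omega)
  rw [th_split k hk, ths_split k hk, ths_split (2 * k) (by omega)]
  rw [show 2 * (2 * k) = 4 * k by ring] at h2
  rw [show 4 * (2 * k) = 8 * k by ring] at h2 ⊢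
  linear_combination h2 - h1

end gf

section binary

def c4 (x : ℤ) : ℤ := if x % 4 = 1 then 1 else if x % 4 = 3 then -1 else 0
def d8 (x : ℤ) : ℤ := if x % 8 = 1 ∨ x % 8 = 3 then 1 else if x % 8 = 5 ∨ x % 8 = 7 then -1 else 0
def c8 (x : ℤ) : ℤ := if x % 8 = 1 ∨ x % 8 = 7 then 1 else if x % 8 = 3 ∨ x % 8 = 5 then -1 else 0

lemma c4_mul (x y : ℤ) : c4 (x * y) = c4 x * c4 y := by
  have h : ∀ x, c4 x = ZMod.χ₄ x := by
    intro x; rw [ZMod.χ₄_int_eq_if_mod_four, c4]; split_ifs <;> omega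
  rw [h, h, h]; push_cast; rw [map_mul]

lemma d8_mul (x y : ℤ) : d8 (x * y) = d8 x * d8 y := by
  have h : ∀ x, d8 x = ZMod.χ₈' x := by
    intro x; rw [ZMod.χ₈'_int_eq_if_mod_eight, d8]; split_ifs <;> omega
  rw [h, h, h]; push_cast; rw [map_mul]

lemma c8_mul (x y : ℤ) : c8 (x * y) = c8 x * c8 y := by
  have h : ∀ x, c8 x = ZMod.χ₈ x := by
    intro x; rw [ZMod.χ₈_int_eq_if_mod_eight, c8]; split_ifs <;> omega
  rw [h, h, h]; push_cast; rw [map_mul]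

def gs (χ : ℤ → ℤ) (n : ℕ) : ℤ := ∑ d ∈ n.divisors, χ d

lemma gs_hecke (χ : ℤ → ℤ) (hχ : ∀ x y, χ (x * y) = χ x * χ y) (p n : ℕ) (hp : p.Prime) (hn : 0 < n) :
    gs χ (p * n) + χ p * (if p ∣ n then gs χ (n / p) else 0) = (1 + χ p) * gs χ n := by
  classical
  have hp0 := hp.pos
  have inj : Function.Injective (fun d : ℕ => p * d) := fun a b h => Nat.eq_of_mul_eq_mul_left hp0 h
  have e1 : (p * n).divisors = n.divisors ∪ n.divisors.image (fun d => p * d) := by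
    ext d
    simp only [Nat.mem_divisors, Finset.mem_union, Finset.mem_image]
    constructor
    · rintro ⟨h, _⟩
      by_cases hd : p ∣ d
      · obtain ⟨e, rfl⟩ := hd
        right; exact ⟨e, ⟨Nat.dvd_of_mul_dvd_mul_left hp0 h, by omega⟩, rfl⟩
      · left
        exact ⟨(Nat.Coprime.symm ((Nat.Prime.coprime_iff_not_dvd hp).2 hd)).dvd_of_dvd_mul_left h, by omega⟩
    · rintro (⟨h, _⟩ | ⟨e, ⟨h, _⟩, rfl⟩)
      · exact ⟨Dvd.dvd.mul_left h p, by positivity⟩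
      · exact ⟨Nat.mul_dvd_mul_left p h, by positivity⟩
  have e2 : χ p * (if p ∣ n then gs χ (n / p) else 0) =
      ∑ d ∈ n.divisors ∩ n.divisors.image (fun d => p * d), χ d := by
    split_ifs with h
    · obtain ⟨m, rfl⟩ := h
      have hm : 0 < m := Nat.pos_of_mul_pos_left hn
      rw [Nat.mul_div_cancel_left _ hp0]
      have : (p * m).divisors ∩ (p * m).divisors.image (fun d => p * d) =
          m.divisors.image (fun d => p * d) := by
        ext d
        simp only [Nat.mem_divisors, Finset.mem_inter, Finset.mem_image]
        constructor
        · rintro ⟨⟨h, _⟩, e, ⟨h', _⟩, rfl⟩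
          exact ⟨e, ⟨Nat.dvd_of_mul_dvd_mul_left hp0 h, by omega⟩, rfl⟩
        · rintro ⟨e, ⟨h', _⟩, rfl⟩
          exact ⟨⟨Nat.mul_dvd_mul_left p h', by positivity⟩, e, ⟨Dvd.dvd.mul_left h' p, by positivity⟩, rfl⟩
      rw [this, Finset.sum_image inj.injOn, gs, Finset.mul_sum]
      exact Finset.sum_congr rfl fun d _ => by push_cast; rw [hχ]
    · rw [mul_zero, eq_comm]
      apply Finset.sum_eq_zero
      intro d hd
      simp only [Nat.mem_divisors, Finset.mem_inter, Finset.mem_image] at hd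
      obtain ⟨⟨h1, _⟩, e, _, rfl⟩ := hd
      exact absurd (dvd_trans (dvd_mul_right p e) h1) h
  rw [e2]
  unfold gs
  rw [e1, Finset.sum_union_inter, Finset.sum_image inj.injOn, add_mul, one_mul, Finset.mul_sum]
  congr 1
  exact Finset.sum_congr rfl fun d _ => by push_cast; rw [hχ]

def RS (D c n : ℤ) : Set (ℤ × ℤ) := {P | c * (P.1 ^ 2 + D * P.2 ^ 2) = n}

lemma RS_fin (D c n : ℤ) (hD : 0 < D) (hc : 0 < c) : (RS D c n).Finite := by
  refine Set.Finite.subset (Set.finite_Icc ((-n, -n) : ℤ × ℤ) (n, n)) ?_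
  rintro ⟨x, y⟩ h
  simp only [RS, Set.mem_ofPred_eq] at h
  have h1 : x ^ 2 + y ^ 2 ≤ n := by
    have : x ^ 2 + y ^ 2 ≤ x ^ 2 + D * y ^ 2 := by nlinarith [sq_nonneg y]
    have : x ^ 2 + D * y ^ 2 ≤ c * (x ^ 2 + D * y ^ 2) := by nlinarith [sq_nonneg x, sq_nonneg y]
    linarith
  simp only [Set.mem_Icc, Prod.le_def]
  have hx : x ≤ x ^ 2 := Int.le_self_sq x
  have hx' : -x ≤ x ^ 2 := by have := Int.le_self_sq (-x); simpa using this
  have hy : y ≤ y ^ 2 := Int.le_self_sq y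
  have hy' : -y ≤ y ^ 2 := by have := Int.le_self_sq (-y); simpa using this
  refine ⟨⟨?_, ?_⟩, ?_, ?_⟩ <;> nlinarith [sq_nonneg x, sq_nonneg y]

lemma RS_scale (D p n : ℤ) (hp : 0 < p) :
    RS D 1 (p * n) ∩ {P | p ∣ P.1 ∧ p ∣ P.2} = (fun P : ℤ × ℤ => (p * P.1, p * P.2)) '' RS D p n := by
  ext ⟨x, y⟩
  simp only [RS, Set.mem_inter_iff, Set.mem_ofPred_eq, Set.mem_image, Prod.mk.injEq, Prod.exists]
  constructor
  · rintro ⟨h, ⟨a, rfl⟩, b, rfl⟩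
    refine ⟨a, b, ?_, rfl, rfl⟩
    apply mul_left_cancel₀ hp.ne'
    linear_combination h
  · rintro ⟨a, b, h, rfl, rfl⟩
    exact ⟨by linear_combination p * h, dvd_mul_right _ _, dvd_mul_right _ _⟩

lemma RS_scale_card (D p n : ℤ) (hp : 0 < p) :
    (RS D 1 (p * n) ∩ {P | p ∣ P.1 ∧ p ∣ P.2}).ncard = (RS D p n).ncard := by
  rw [RS_scale D p n hp, Set.ncard_image_of_injective]
  rintro ⟨x, y⟩ ⟨x', y'⟩ h
  simp only [Prod.mk.injEq] at h ⊢
  exact ⟨mul_left_cancel₀ hp.ne' h.1, mul_left_cancel₀ hp.ne' h.2⟩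

lemma RS_mul (D p a b n : ℤ) (hD : 0 < D) (hp : Prime p) (hp0 : 0 < p) (hpD : ¬ p ∣ D)
    (hab : p = a ^ 2 + D * b ^ 2) :
    (RS D 1 (p * n) ∩ {P | p ∣ a * P.1 + D * b * P.2}).ncard = (RS D 1 n).ncard := by
  have : RS D 1 (p * n) ∩ {P | p ∣ a * P.1 + D * b * P.2} =
      (fun P : ℤ × ℤ => (a * P.1 - D * b * P.2, b * P.1 + a * P.2)) '' RS D 1 n := by
    ext ⟨x, y⟩
    simp only [RS, Set.mem_inter_iff, Set.mem_ofPred_eq, Set.mem_image, Prod.mk.injEq, Prod.exists]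
    constructor
    · rintro ⟨h, u, hu⟩
      have h2 : p ∣ a * y - b * x := by
        have : p ∣ D * (a * y - b * x) ^ 2 := by
          refine ⟨p * n - p * u ^ 2, ?_⟩
          have e : (a * x + D * b * y) ^ 2 + D * (a * y - b * x) ^ 2 = p * (x ^ 2 + D * y ^ 2) := by
            rw [hab]; ring
          rw [hu] at e
          linear_combination e + p * h
        rcases hp.dvd_or_dvd this with h | h
        · exact absurd h hpD
        · exact hp.dvd_of_dvd_pow h
      obtain ⟨v, hv⟩ := h2
      refine ⟨u, v, ?_, ?_, ?_⟩
      · apply mul_left_cancel₀ (pow_ne_zero 2 hp0.ne')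
        have e : (a * x + D * b * y) ^ 2 + D * (a * y - b * x) ^ 2 = p * (x ^ 2 + D * y ^ 2) := by
          rw [hab]; ring
        rw [hu, hv] at e
        linear_combination e + p * h
      · apply mul_left_cancel₀ hp0.ne'
        linear_combination -a * hu + D * b * hv - x * hab
      · apply mul_left_cancel₀ hp0.ne'
        linear_combination -b * hu - a * hv - y * hab
    · rintro ⟨u, v, h, rfl, rfl⟩
      refine ⟨?_, u, ?_⟩
      · rw [hab]; linear_combination (a ^ 2 + D * b ^ 2) * h
      · rw [hab]; ring
  rw [this, Set.ncard_image_of_injective]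
  rintro ⟨x, y⟩ ⟨x', y'⟩ h
  simp only [Prod.mk.injEq] at h ⊢
  constructor
  · apply mul_left_cancel₀ hp0.ne'
    rw [hab]; linear_combination a * h.1 + D * b * h.2
  · apply mul_left_cancel₀ hp0.ne'
    rw [hab]; linear_combination -b * h.1 + a * h.2

lemma RS_split (D p a b n : ℤ) (hD : 0 < D) (hp : Prime p) (hp0 : 0 < p) (hpD : ¬ p ∣ D)
    (hp2 : ¬ p ∣ 2) (hab : p = a ^ 2 + D * b ^ 2) :
    (RS D 1 (p * n)).ncard + (RS D p n).ncard = 2 * (RS D 1 n).ncard := by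
  have h1 := RS_mul D p a b n hD hp hp0 hpD hab
  have h2 := RS_mul D p a (-b) n hD hp hp0 hpD (by rw [hab]; ring)
  have hpa : ¬ p ∣ a := by
    rintro ⟨c, rfl⟩
    have : p ∣ D * b ^ 2 := ⟨1 - p * c ^ 2, by linear_combination -hab⟩
    rcases hp.dvd_or_dvd this with h | h
    · exact hpD h
    · obtain ⟨e, rfl⟩ := hp.dvd_of_dvd_pow h
      have : p * 1 = p * (p * (c ^ 2 + D * e ^ 2)) := by linear_combination hab
      have := mul_left_cancel₀ hp0.ne' this
      exact hp.not_isUnit (IsUnit.of_mul_eq_one _ this.symm)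
  rw [← RS_scale_card D p n hp0, two_mul]
  nth_rewrite 1 [← h1]
  rw [← h2]
  have fin := RS_fin D 1 (p * n) hD one_pos
  rw [← Set.ncard_union_add_ncard_inter _ _ (fin.inter_of_left _) (fin.inter_of_left _)]
  have key : ∀ x y : ℤ, (x, y) ∈ RS D 1 (p * n) → p ∣ (a * x + D * b * y) * (a * x + D * (-b) * y) := by
    intro x y h
    simp only [RS, Set.mem_ofPred_eq] at h
    refine ⟨x ^ 2 - D * b ^ 2 * n, ?_⟩
    linear_combination -x ^ 2 * hab - D * b ^ 2 * h
  congr 2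
  · rw [← Set.inter_union_distrib_left, eq_comm, Set.inter_eq_left]
    rintro ⟨x, y⟩ h
    exact hp.dvd_or_dvd (key x y h)
  · ext ⟨x, y⟩
    simp only [Set.mem_inter_iff, Set.mem_ofPred_eq]
    constructor
    · rintro ⟨h, ⟨u, rfl⟩, v, rfl⟩
      exact ⟨⟨h, ⟨a * u + D * b * v, by ring⟩⟩, h, ⟨a * u - D * b * v, by ring⟩⟩
    · rintro ⟨⟨h, h1⟩, _, h2⟩
      have hx : p ∣ x := by
        have : p ∣ 2 * (a * x) := by
          have := dvd_add h1 h2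
          ring_nf at this ⊢; exact this
        rcases hp.dvd_or_dvd this with h | h
        · exact absurd h hp2
        · exact (hp.dvd_or_dvd h).resolve_left hpa
      refine ⟨h, hx, ?_⟩
      simp only [RS, Set.mem_ofPred_eq] at h
      obtain ⟨u, rfl⟩ := hx
      have : p ∣ D * y ^ 2 := ⟨n - p * u ^ 2, by linear_combination h⟩
      rcases hp.dvd_or_dvd this with h | h
      · exact absurd h hpD
      · exact hp.dvd_of_dvd_pow h

lemma RS_inert (D p n : ℤ) (hp0 : 0 < p)
    (h : ∀ x y, p ∣ x ^ 2 + D * y ^ 2 → p ∣ x ∧ p ∣ y) :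
    (RS D 1 (p * n)).ncard = (RS D p n).ncard := by
  rw [← RS_scale_card D p n hp0]
  congr 1
  rw [eq_comm, Set.inter_eq_left]
  rintro ⟨x, y⟩ hx
  simp only [RS, Set.mem_ofPred_eq] at hx
  exact h x y ⟨n, by linear_combination hx⟩

lemma RS_div (D : ℤ) (p n : ℕ) (hp0 : 0 < p) :
    ((RS D p n).ncard : ℤ) = if p ∣ n then ((RS D 1 (n / p : ℕ)).ncard : ℤ) else 0 := by
  split_ifs with h
  · obtain ⟨m, rfl⟩ := h
    rw [Nat.mul_div_cancel_left _ hp0]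
    congr 2
    ext ⟨x, y⟩
    simp only [RS, Set.mem_ofPred_eq]
    push_cast
    rw [one_mul]
    have : (p : ℤ) ≠ 0 := by positivity
    exact mul_right_inj' this
  · have : RS D p n = ∅ := by
      ext ⟨x, y⟩
      simp only [RS, Set.mem_ofPred_eq, Set.mem_empty_iff_false, iff_false]
      intro hh
      apply h
      exact Int.natCast_dvd_natCast.1 ⟨_, hh.symm⟩
    rw [this]; simp

/-- generic induction -/
lemma RS_count (D c : ℤ) (χ : ℤ → ℤ) (hχ : ∀ x y, χ (x * y) = χ x * χ y) (hχ1 : χ 1 = 1)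
    (h1 : ((RS D 1 1).ncard : ℤ) = c)
    (hp : ∀ p n : ℕ, p.Prime → 0 < n → ((RS D 1 (p * n : ℕ)).ncard : ℤ) + χ p * (RS D p n).ncard
      = (1 + χ p) * (RS D 1 n).ncard) (n : ℕ) (hn : 0 < n) :
    ((RS D 1 n).ncard : ℤ) = c * gs χ n := by
  induction n using Nat.strong_induction_on with
  | _ n ih =>
    by_cases hn1 : n = 1
    · subst hn1; simp [gs, hχ1, h1]
    · obtain ⟨p, hpp, m, rfl⟩ := Nat.exists_prime_and_dvd hn1
      have hm : 0 < m := Nat.pos_of_mul_pos_left hn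
      have hlt : m < p * m := by nlinarith [hpp.two_le]
      have e1 := hp p m hpp hm
      have e2 := gs_hecke χ hχ p m hpp hm
      rw [RS_div D p m hpp.pos, ih m hlt hm] at e1
      have e3 : (if p ∣ m then ((RS D 1 (m / p : ℕ)).ncard : ℤ) else 0) =
          c * (if p ∣ m then gs χ (m / p) else 0) := by
        split_ifs with h
        · apply ih
          · exact lt_of_le_of_lt (Nat.div_le_self _ _) hlt
          · exact Nat.div_pos (Nat.le_of_dvd hm h) hpp.pos
        · simp
      rw [e3] at e1
      linear_combination e1 - c * e2

end binary

section binary2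

lemma inert_aux (D : ℤ) (p : ℕ) [Fact p.Prime] (h : ¬ IsSquare (-(D : ZMod p))) (x y : ℤ)
    (hxy : (p : ℤ) ∣ x ^ 2 + D * y ^ 2) : (p : ℤ) ∣ x ∧ (p : ℤ) ∣ y := by
  rw [← ZMod.intCast_zmod_eq_zero_iff_dvd] at hxy
  rw [← ZMod.intCast_zmod_eq_zero_iff_dvd, ← ZMod.intCast_zmod_eq_zero_iff_dvd]
  push_cast at hxy
  have hy : (y : ZMod p) = 0 := by
    by_contra hy
    apply h
    refine ⟨(x : ZMod p) / y, ?_⟩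
    field_simp
    linear_combination -hxy
  refine ⟨?_, hy⟩
  rw [hy] at hxy
  have : (x : ZMod p) ^ 2 = 0 := by linear_combination hxy
  exact pow_eq_zero_iff (two_ne_zero) |>.1 this

lemma thue (p : ℕ) [hp : Fact p.Prime] (s : ZMod p) :
    ∃ x y : ℤ, (x ≠ 0 ∨ y ≠ 0) ∧ x ^ 2 < p ∧ y ^ 2 < p ∧ (x : ZMod p) = s * y := by
  classical
  set r := Nat.sqrt p with hr
  have hr1 : r * r ≤ p := Nat.sqrt_le p
  have hr2 : p < (r + 1) * (r + 1) := Nat.lt_succ_sqrt p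
  have hne : r * r ≠ p := by
    intro h
    have h1 : IsSquare p := ⟨r, h.symm⟩
    exact (Nat.prime_iff.1 hp.out).irreducible.not_isSquare h1
  let f : Fin (r + 1) × Fin (r + 1) → ZMod p := fun ab => (ab.1.val : ZMod p) - s * (ab.2.val : ZMod p)
  have hcard : Fintype.card (ZMod p) < Fintype.card (Fin (r + 1) × Fin (r + 1)) := by
    rw [ZMod.card, Fintype.card_prod, Fintype.card_fin]; exact hr2
  obtain ⟨⟨a, b⟩, ⟨c, d⟩, hne', hf⟩ := Fintype.exists_ne_map_eq_of_card_lt f hcard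
  have ha := a.isLt
  have hb := b.isLt
  have hc := c.isLt
  have hd := d.isLt
  have bd : ∀ u v : ℕ, u < r + 1 → v < r + 1 → ((u : ℤ) - v) ^ 2 < p := by
    intro u v hu hv
    have h1 : ((u : ℤ) - v) ^ 2 ≤ (r : ℤ) ^ 2 := by
      apply sq_le_sq'  <;> omega
    have h2 : (r : ℤ) * r < p := by exact_mod_cast lt_of_le_of_ne hr1 hne
    nlinarith
  refine ⟨(a.val : ℤ) - c.val, (b.val : ℤ) - d.val, ?_, bd _ _ ha hc, bd _ _ hb hd, ?_⟩
  · by_contra! h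
    apply hne'
    ext <;> simp <;> omega
  · simp only [f] at hf
    push_cast
    linear_combination hf

lemma rep_two (p : ℕ) [hp : Fact p.Prime] (h2 : p ≠ 2) (h : IsSquare (-2 : ZMod p)) :
    ∃ a b : ℤ, (p : ℤ) = a ^ 2 + 2 * b ^ 2 := by
  obtain ⟨s, hs⟩ := h
  obtain ⟨x, y, h0, hx, hy, hxy⟩ := thue p s
  have hd : (p : ℤ) ∣ x ^ 2 + 2 * y ^ 2 := by
    rw [← ZMod.intCast_zmod_eq_zero_iff_dvd]
    push_cast
    rw [hxy]
    linear_combination -(y : ZMod p) ^ 2 * hs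
  obtain ⟨k, hk⟩ := hd
  have hp0 : (0 : ℤ) < p := by exact_mod_cast hp.out.pos
  have hk3 : k < 3 := by
    by_contra! h
    nlinarith
  have hk0 : 0 < k := by
    have : 0 < x ^ 2 + 2 * y ^ 2 := by
      rcases h0 with h | h
      · have := sq_pos_of_ne_zero h; nlinarith [sq_nonneg y]
      · have := sq_pos_of_ne_zero h; nlinarith [sq_nonneg x]
    rw [hk] at this
    exact (mul_pos_iff_of_pos_left hp0).1 this
  interval_cases k
  · exact ⟨x, y, by linarith⟩
  · have : (2 : ℤ) ∣ x ^ 2 := ⟨p - y ^ 2, by linarith⟩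
    obtain ⟨z, rfl⟩ := Int.prime_two.dvd_of_dvd_pow this
    exact ⟨y, z, by linarith⟩

lemma r2_count (n : ℕ) (hn : 0 < n) : ((RS 1 1 n).ncard : ℤ) = 4 * gs c4 n := by
  apply RS_count 1 4 c4 c4_mul (by decide) _ _ n hn
  · have : RS 1 1 1 = (({(1, 0), (-1, 0), (0, 1), (0, -1)} : Finset (ℤ × ℤ)) : Set (ℤ × ℤ)) := by
      ext ⟨x, y⟩
      simp [RS]
      constructor
      · intro h
        have : x ≤ 1 := by nlinarith
        have : -1 ≤ x := by nlinarith
        have : y ≤ 1 := by nlinarith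
        have : -1 ≤ y := by nlinarith
        interval_cases x <;> interval_cases y <;> simp_all
      · rintro (⟨rfl, rfl⟩ | ⟨rfl, rfl⟩ | ⟨rfl, rfl⟩ | ⟨rfl, rfl⟩) <;> norm_num
    rw [this, Set.ncard_coe_finset]; rfl
  · intro p n hp hn
    have := Fact.mk hp
    have hpp : Prime (p : ℤ) := Nat.prime_iff_prime_int.1 hp
    have hp0 : (0 : ℤ) < p := by exact_mod_cast hp.pos
    rcases hp.eq_two_or_odd' with rfl | hodd
    · have : RS 1 1 (2 * n : ℕ) = (fun P : ℤ × ℤ => (P.1 + P.2, P.1 - P.2)) '' RS 1 1 n := by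
        ext ⟨x, y⟩
        simp only [RS, Set.mem_ofPred_eq, Set.mem_image, Prod.mk.injEq, Prod.exists]
        push_cast
        constructor
        · intro h
          have h2 : (2 : ℤ) ∣ x + y := by
            have : (2 : ℤ) ∣ (x + y) ^ 2 := ⟨n + x * y, by linarith⟩
            exact Int.prime_two.dvd_of_dvd_pow this
          obtain ⟨a, ha⟩ := h2
          refine ⟨a, x - a, ?_, by ring, by linarith⟩
          have : y = 2 * a - x := by linarith
          subst this
          nlinarith
        · rintro ⟨a, b, h, rfl, rfl⟩; linarith
      rw [this, Set.ncard_image_of_injective]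
      · simp [c4]
      · rintro ⟨x, y⟩ ⟨x', y'⟩ h
        simp only [Prod.mk.injEq] at h ⊢
        omega
    · have h2 : ¬ (p : ℤ) ∣ 2 := by
        intro h
        have : p ∣ 2 := by exact_mod_cast h
        have := (Nat.prime_dvd_prime_iff_eq hp Nat.prime_two).1 this
        subst this; revert hodd; decide
      have hodd' : p % 2 = 1 := Nat.odd_iff.1 hodd
      by_cases h4 : p % 4 = 3
      · have : c4 p = -1 := by unfold c4; split_ifs <;> omega
        have e := RS_inert 1 p n hp0 (fun x y h => inert_aux 1 p (by
          intro h; push_cast at h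
          exact (ZMod.exists_sq_eq_neg_one_iff.1 h) h4) x y h)
        push_cast
        rw [this, e]; ring
      · have : c4 p = 1 := by unfold c4; split_ifs <;> omega
        obtain ⟨a, b, hab⟩ := Nat.Prime.sq_add_sq h4
        have e := RS_split 1 p a b n one_pos hpp hp0 (by
          intro h; exact hpp.not_isUnit (isUnit_of_dvd_one h)) h2 (by rw [← hab]; push_cast; ring)
        push_cast
        rw [this]
        linarith

lemma r12_count (n : ℕ) (hn : 0 < n) : ((RS 2 1 n).ncard : ℤ) = 2 * gs d8 n := by
  apply RS_count 2 2 d8 d8_mul (by decide) _ _ n hn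
  · have : RS 2 1 1 = (({(1, 0), (-1, 0)} : Finset (ℤ × ℤ)) : Set (ℤ × ℤ)) := by
      ext ⟨x, y⟩
      simp [RS]
      constructor
      · intro h
        have : x ≤ 1 := by nlinarith
        have : -1 ≤ x := by nlinarith
        have : y ≤ 1 := by nlinarith
        have : -1 ≤ y := by nlinarith
        interval_cases x <;> interval_cases y <;> simp_all
      · rintro (⟨rfl, rfl⟩ | ⟨rfl, rfl⟩) <;> norm_num
    rw [this, Set.ncard_coe_finset]; rfl
  · intro p n hp hn
    have := Fact.mk hp
    have hpp : Prime (p : ℤ) := Nat.prime_iff_prime_int.1 hp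
    have hp0 : (0 : ℤ) < p := by exact_mod_cast hp.pos
    rcases hp.eq_two_or_odd' with rfl | hodd
    · have : RS 2 1 (2 * n : ℕ) = (fun P : ℤ × ℤ => (2 * P.2, P.1)) '' RS 2 1 n := by
        ext ⟨x, y⟩
        simp only [RS, Set.mem_ofPred_eq, Set.mem_image, Prod.mk.injEq, Prod.exists]
        push_cast
        constructor
        · intro h
          have h2 : (2 : ℤ) ∣ x := by
            have : (2 : ℤ) ∣ x ^ 2 := ⟨n - y ^ 2, by linarith⟩
            exact Int.prime_two.dvd_of_dvd_pow this
          obtain ⟨a, rfl⟩ := h2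
          exact ⟨a, by linarith, rfl, rfl⟩
        · rintro ⟨b, h, rfl, -⟩; linarith
      rw [this, Set.ncard_image_of_injective]
      · simp [d8]
      · rintro ⟨x, y⟩ ⟨x', y'⟩ h
        simp only [Prod.mk.injEq] at h ⊢
        omega
    · have h2 : ¬ (p : ℤ) ∣ 2 := by
        intro h
        have : p ∣ 2 := by exact_mod_cast h
        have := (Nat.prime_dvd_prime_iff_eq hp Nat.prime_two).1 this
        subst this; revert hodd; decide
      have hodd' : p % 2 = 1 := Nat.odd_iff.1 hodd
      have hne : p ≠ 2 := by omega
      by_cases h4 : p % 8 = 1 ∨ p % 8 = 3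
      · have : d8 p = 1 := by unfold d8; split_ifs <;> omega
        obtain ⟨a, b, hab⟩ := rep_two p hne ((ZMod.exists_sq_eq_neg_two_iff hne).2 h4)
        have e := RS_split 2 p a b n two_pos hpp hp0 h2 h2 hab
        push_cast
        rw [this]
        linarith
      · have : d8 p = -1 := by unfold d8; split_ifs <;> omega
        have e := RS_inert 2 p n hp0 (fun x y h => inert_aux 2 p (by
          intro h; push_cast at h
          exact h4 ((ZMod.exists_sq_eq_neg_two_iff hne).1 h)) x y h)
        push_cast
        rw [this, e]; ring

end binary2

section liouville

def uu (x : ℤ) : ℤ := if x % 8 = 3 then 1 else if x % 8 = 5 then -1 else 0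

lemma mul_mod8 (a d r : ℤ) (hr : d % 8 = r) : (a * d) % 8 = ((a % 8) * r) % 8 := by
  rw [Int.mul_emod, hr]

lemma gs_d8 (L : ℕ) (hL : L % 8 = 3) : gs d8 L = 2 * gs uu L := by
  have h1 : ∀ f : ℤ → ℤ, gs f L = ∑ x ∈ L.divisorsAntidiagonal, f (x.1 : ℕ) := by
    intro f; rw [Nat.sum_divisorsAntidiagonal (fun d _ => f (d : ℤ))]; rfl
  have h2 : ∀ f : ℤ → ℤ, gs f L = ∑ x ∈ L.divisorsAntidiagonal, f (x.2 : ℕ) := by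
    intro f; rw [Nat.sum_divisorsAntidiagonal' (fun _ d => f (d : ℤ))]; rfl
  rw [two_mul]
  nth_rewrite 2 [h1]
  rw [h2, h2, ← Finset.sum_add_distrib]
  refine Finset.sum_congr rfl fun x hx => ?_
  obtain ⟨a, d⟩ := x
  have h := (Nat.mem_divisorsAntidiagonal.1 hx).1
  simp only at h ⊢
  have h' : ((a : ℤ) * d) % 8 = 3 := by
    have : ((a : ℤ) * d) = L := by exact_mod_cast h
    omega
  generalize (a : ℤ) = a at *
  generalize (d : ℤ) = d at *
  have : d % 8 = 0 ∨ d % 8 = 1 ∨ d % 8 = 2 ∨ d % 8 = 3 ∨ d % 8 = 4 ∨ d % 8 = 5 ∨ d % 8 = 6 ∨ d % 8 = 7 := by omega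
  unfold d8 uu
  rcases this with h0 | h0 | h0 | h0 | h0 | h0 | h0 | h0 <;> rw [mul_mod8 _ _ _ h0] at h' <;>
    split_ifs <;> omega

lemma gs_c4 (L : ℕ) (hL : L % 8 = 5) : gs c4 L = -(2 * gs uu L) := by
  have h1 : ∀ f : ℤ → ℤ, gs f L = ∑ x ∈ L.divisorsAntidiagonal, f (x.1 : ℕ) := by
    intro f; rw [Nat.sum_divisorsAntidiagonal (fun d _ => f (d : ℤ))]; rfl
  have h2 : ∀ f : ℤ → ℤ, gs f L = ∑ x ∈ L.divisorsAntidiagonal, f (x.2 : ℕ) := by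
    intro f; rw [Nat.sum_divisorsAntidiagonal' (fun _ d => f (d : ℤ))]; rfl
  rw [two_mul]
  nth_rewrite 2 [h1]
  rw [h2, h2, ← Finset.sum_add_distrib, ← Finset.sum_neg_distrib]
  refine Finset.sum_congr rfl fun x hx => ?_
  obtain ⟨a, d⟩ := x
  have h := (Nat.mem_divisorsAntidiagonal.1 hx).1
  simp only at h ⊢
  have h' : ((a : ℤ) * d) % 8 = 5 := by
    have : ((a : ℤ) * d) = L := by exact_mod_cast h
    omega
  generalize (a : ℤ) = a at *
  generalize (d : ℤ) = d at *
  have : d % 8 = 0 ∨ d % 8 = 1 ∨ d % 8 = 2 ∨ d % 8 = 3 ∨ d % 8 = 4 ∨ d % 8 = 5 ∨ d % 8 = 6 ∨ d % 8 = 7 := by omega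
  unfold c4 uu
  rcases this with h0 | h0 | h0 | h0 | h0 | h0 | h0 | h0 <;> rw [mul_mod8 _ _ _ h0] at h' <;>
    split_ifs <;> omega

noncomputable def TT (Q : ℤ) : Finset (ℤ × ℤ × ℤ × ℤ) :=
  (Finset.Icc ((1, 1, 1, 1) : ℤ × ℤ × ℤ × ℤ) (Q, Q, Q, Q)).filter
    (fun x => x.1 * x.2.1 + x.2.2.1 * x.2.2.2 = Q)

lemma mem_TT (Q a d b e : ℤ) : (a, d, b, e) ∈ TT Q ↔
    0 < a ∧ 0 < d ∧ 0 < b ∧ 0 < e ∧ a * d + b * e = Q := by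
  simp only [TT, Finset.mem_filter, Finset.mem_Icc, Prod.mk_le_mk]
  constructor
  · rintro ⟨⟨⟨h1, h2, h3, h4⟩, -⟩, h5⟩
    refine ⟨by omega, by omega, by omega, by omega, h5⟩
  · rintro ⟨h1, h2, h3, h4, h5⟩
    refine ⟨⟨⟨by omega, by omega, by omega, by omega⟩, ?_, ?_, ?_, ?_⟩, h5⟩ <;>
    nlinarith [mul_pos h1 h2, mul_pos h3 h4]

lemma sum_TT (Q : ℕ) (f : ℤ → ℤ → ℤ → ℤ → ℤ) :
    ∑ LK ∈ Finset.HasAntidiagonal.antidiagonal Q, ∑ x ∈ LK.1.divisorsAntidiagonal,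
      ∑ y ∈ LK.2.divisorsAntidiagonal, f x.1 x.2 y.1 y.2 =
    ∑ x ∈ TT Q, f x.1 x.2.1 x.2.2.1 x.2.2.2 := by
  simp_rw [← Finset.sum_product']
  rw [Finset.sum_sigma']
  refine Finset.sum_nbij' (fun s => ((s.2.1.1 : ℤ), (s.2.1.2 : ℤ), (s.2.2.1 : ℤ), (s.2.2.2 : ℤ)))
    (fun x => ⟨(x.1.toNat * x.2.1.toNat, x.2.2.1.toNat * x.2.2.2.toNat),
      (x.1.toNat, x.2.1.toNat), (x.2.2.1.toNat, x.2.2.2.toNat)⟩) ?_ ?_ ?_ ?_ ?_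
  · rintro ⟨⟨L, K⟩, ⟨a, d⟩, b, e⟩ h
    simp only [Finset.mem_sigma, Finset.HasAntidiagonal.mem_antidiagonal, Finset.mem_product,
      Nat.mem_divisorsAntidiagonal] at h
    obtain ⟨h1, ⟨rfl, h2⟩, rfl, h3⟩ := h
    change ((a : ℤ), (d : ℤ), (b : ℤ), (e : ℤ)) ∈ TT Q
    rw [mem_TT]
    have p1 := left_ne_zero_of_mul h2
    have p2 := right_ne_zero_of_mul h2
    have p3 := left_ne_zero_of_mul h3
    have p4 := right_ne_zero_of_mul h3
    clear h2 h3
    have h1' : (a : ℤ) * d + b * e = Q := by exact_mod_cast h1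
    clear h1
    refine ⟨by omega, by omega, by omega, by omega, h1'⟩
  · rintro ⟨a, d, b, e⟩ h
    rw [mem_TT] at h
    obtain ⟨h1, h2, h3, h4, h5⟩ := h
    lift a to ℕ using h1.le
    lift b to ℕ using h3.le
    lift d to ℕ using h2.le
    lift e to ℕ using h4.le
    simp only [Finset.mem_sigma, Finset.HasAntidiagonal.mem_antidiagonal, Finset.mem_product,
      Nat.mem_divisorsAntidiagonal, Int.toNat_natCast, mul_ne_zero_iff]
    refine ⟨by exact_mod_cast h5, ⟨trivial, by omega, by omega⟩, trivial, by omega, by omega⟩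
  · rintro ⟨⟨L, K⟩, ⟨a, d⟩, b, e⟩ h
    simp only [Finset.mem_sigma, Finset.HasAntidiagonal.mem_antidiagonal, Finset.mem_product,
      Nat.mem_divisorsAntidiagonal] at h
    obtain ⟨h1, ⟨rfl, h2⟩, rfl, h3⟩ := h
    simp
  · rintro ⟨a, d, b, e⟩ h
    rw [mem_TT] at h
    simp; omega
  · intro _ _; rfl

abbrev CP (x : ℤ × ℤ × ℤ × ℤ) : Prop :=
  (x.1 % 8 = 1 ∧ x.2.1 % 8 = 3 ∧ x.2.2.1 % 8 = 7 ∧ x.2.2.2 % 8 = 3) ∨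
  (x.1 % 8 = 7 ∧ x.2.1 % 8 = 5 ∧ x.2.2.1 % 8 = 1 ∧ x.2.2.2 % 8 = 5)
abbrev CM (x : ℤ × ℤ × ℤ × ℤ) : Prop :=
  (x.1 % 8 = 1 ∧ x.2.1 % 8 = 3 ∧ x.2.2.1 % 8 = 1 ∧ x.2.2.2 % 8 = 5) ∨
  (x.1 % 8 = 7 ∧ x.2.1 % 8 = 5 ∧ x.2.2.1 % 8 = 7 ∧ x.2.2.2 % 8 = 3)
/-- (a,k,c,e) -/
abbrev CU (x : ℤ × ℤ × ℤ × ℤ) : Prop :=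
  (x.1 % 8 = 1 ∨ x.1 % 8 = 7) ∧ x.2.1 % 8 = 0 ∧ x.2.2.1 % 8 = 0 ∧ (x.2.2.2 % 8 = 3 ∨ x.2.2.2 % 8 = 5)

lemma U_eq (Q : ℤ) : ((TT Q).filter (fun x => CU x ∧ x.2.2.1 < x.1)).card =
    ((TT Q).filter (fun x => CU x ∧ x.2.1 < x.2.2.2)).card := by
  refine Finset.card_nbij' (fun x => (x.1 - x.2.2.1, x.2.1, x.2.2.1, x.2.2.2 + x.2.1))
    (fun x => (x.1 + x.2.2.1, x.2.1, x.2.2.1, x.2.2.2 - x.2.1)) ?_ ?_ ?_ ?_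
  · rintro ⟨a, k, c, e⟩ h
    simp only [Finset.coe_filter, Set.mem_ofPred_eq, mem_TT, CU] at h ⊢
    refine ⟨⟨by omega, by omega, by omega, by omega, by linarith⟩, by omega⟩
  · rintro ⟨a, k, c, e⟩ h
    simp only [Finset.coe_filter, Set.mem_ofPred_eq, mem_TT, CU] at h ⊢
    refine ⟨⟨by omega, by omega, by omega, by omega, by linarith⟩, by omega⟩
  · rintro ⟨a, k, c, e⟩ h
    simp
  · rintro ⟨a, k, c, e⟩ h
    simp

lemma U_eq' (Q : ℤ) : ((TT Q).filter (fun x => CU x ∧ x.1 < x.2.2.1)).card =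
    ((TT Q).filter (fun x => CU x ∧ x.2.2.2 < x.2.1)).card := by
  have h := U_eq Q
  have h1 : ((TT Q).filter CU).card = ((TT Q).filter (fun x => CU x ∧ x.1 < x.2.2.1)).card +
      ((TT Q).filter (fun x => CU x ∧ x.2.2.1 < x.1)).card := by
    rw [← Finset.card_union_of_disjoint]
    · congr 1; ext x; simp only [Finset.mem_filter, Finset.mem_union, CU]
      by_cases hx : x ∈ TT Q
      · simp only [hx, true_and]; omega
      · simp only [hx, false_and, or_false]
    · rw [Finset.disjoint_filter]; intro x _ h; omega
  have h2 : ((TT Q).filter CU).card = ((TT Q).filter (fun x => CU x ∧ x.2.2.2 < x.2.1)).card +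
      ((TT Q).filter (fun x => CU x ∧ x.2.1 < x.2.2.2)).card := by
    rw [← Finset.card_union_of_disjoint]
    · congr 1; ext x; simp only [Finset.mem_filter, Finset.mem_union, CU]
      by_cases hx : x ∈ TT Q
      · simp only [hx, true_and]; omega
      · simp only [hx, false_and, or_false]
    · rw [Finset.disjoint_filter]; intro x _ h; omega
  omega

lemma P_eq (Q : ℤ) : ((TT Q).filter (fun x => CP x ∧ x.2.1 ≠ x.2.2.2)).card =
    ((TT Q).filter (fun x => CU x ∧ x.1 < x.2.2.1)).card := by
  refine Finset.card_nbij'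
    (fun x => if x.2.2.2 < x.2.1 then (x.1, x.2.1 - x.2.2.2, x.1 + x.2.2.1, x.2.2.2)
      else (x.2.2.1, x.2.2.2 - x.2.1, x.1 + x.2.2.1, x.2.1))
    (fun x => if (x.1 % 8 = 1 ∧ x.2.2.2 % 8 = 3) ∨ (x.1 % 8 = 7 ∧ x.2.2.2 % 8 = 5)
      then (x.1, x.2.2.2 + x.2.1, x.2.2.1 - x.1, x.2.2.2)
      else (x.2.2.1 - x.1, x.2.2.2, x.1, x.2.2.2 + x.2.1)) ?_ ?_ ?_ ?_
  · rintro ⟨a, d, b, e⟩ h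
    simp only [Finset.coe_filter, Set.mem_ofPred_eq, mem_TT, CU, CP] at h ⊢
    split_ifs with h0
    · simp only [mem_TT]
      refine ⟨⟨by omega, by omega, by omega, by omega, by linarith⟩, by omega⟩
    · simp only [mem_TT]
      refine ⟨⟨by omega, by omega, by omega, by omega, by linarith⟩, by omega⟩
  · rintro ⟨a, k, c, e⟩ h
    simp only [Finset.coe_filter, Set.mem_ofPred_eq, mem_TT, CU, CP] at h ⊢
    split_ifs with h0
    · simp only [mem_TT]
      refine ⟨⟨by omega, by omega, by omega, by omega, by linarith⟩, by omega⟩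
    · simp only [mem_TT]
      refine ⟨⟨by omega, by omega, by omega, by omega, by linarith⟩, by omega⟩
  · rintro ⟨a, d, b, e⟩ h
    simp only [Finset.coe_filter, Set.mem_ofPred_eq, mem_TT, CP] at h ⊢
    by_cases h0 : e < d
    · simp only [h0, if_true]
      rw [if_pos (by omega)]; simp
    · simp only [h0, if_false]
      rw [if_neg (by omega)]; simp
  · rintro ⟨a, k, c, e⟩ h
    simp only [Finset.coe_filter, Set.mem_ofPred_eq, mem_TT, CU] at h ⊢
    by_cases h0 : (a % 8 = 1 ∧ e % 8 = 3) ∨ (a % 8 = 7 ∧ e % 8 = 5)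
    · simp only [h0, if_true]
      rw [if_pos (by omega)]; simp
    · simp only [h0, if_false]
      rw [if_neg (by omega)]; simp

lemma M_eq (Q : ℤ) : ((TT Q).filter (fun x => CM x ∧ x.1 ≠ x.2.2.1)).card =
    ((TT Q).filter (fun x => CU x ∧ x.2.2.2 < x.2.1)).card := by
  refine Finset.card_nbij'
    (fun x => if x.2.2.1 < x.1 then (x.2.2.1, x.2.1 + x.2.2.2, x.1 - x.2.2.1, x.2.1)
      else (x.1, x.2.1 + x.2.2.2, x.2.2.1 - x.1, x.2.2.2))
    (fun x => if (x.1 % 8 = 1 ∧ x.2.2.2 % 8 = 3) ∨ (x.1 % 8 = 7 ∧ x.2.2.2 % 8 = 5)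
      then (x.1 + x.2.2.1, x.2.2.2, x.1, x.2.1 - x.2.2.2)
      else (x.1, x.2.1 - x.2.2.2, x.1 + x.2.2.1, x.2.2.2)) ?_ ?_ ?_ ?_
  · rintro ⟨a, d, b, e⟩ h
    simp only [Finset.coe_filter, Set.mem_ofPred_eq, mem_TT, CU, CM] at h ⊢
    split_ifs with h0
    · simp only [mem_TT]
      refine ⟨⟨by omega, by omega, by omega, by omega, by linarith⟩, by omega⟩
    · simp only [mem_TT]
      refine ⟨⟨by omega, by omega, by omega, by omega, by linarith⟩, by omega⟩
  · rintro ⟨a, k, c, e⟩ h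
    simp only [Finset.coe_filter, Set.mem_ofPred_eq, mem_TT, CU, CM] at h ⊢
    split_ifs with h0
    · simp only [mem_TT]
      refine ⟨⟨by omega, by omega, by omega, by omega, by linarith⟩, by omega⟩
    · simp only [mem_TT]
      refine ⟨⟨by omega, by omega, by omega, by omega, by linarith⟩, by omega⟩
  · rintro ⟨a, d, b, e⟩ h
    simp only [Finset.coe_filter, Set.mem_ofPred_eq, mem_TT, CM] at h ⊢
    by_cases h0 : b < a
    · simp only [h0, if_true]
      rw [if_pos (by omega)]; simp
    · simp only [h0, if_false]
      rw [if_neg (by omega)]; simp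
  · rintro ⟨a, k, c, e⟩ h
    simp only [Finset.coe_filter, Set.mem_ofPred_eq, mem_TT, CU] at h ⊢
    by_cases h0 : (a % 8 = 1 ∧ e % 8 = 3) ∨ (a % 8 = 7 ∧ e % 8 = 5)
    · simp only [h0, if_true]
      rw [if_pos (by omega)]; simp
    · simp only [h0, if_false]
      rw [if_neg (by omega)]; simp

lemma P_diag (N : ℕ) (hN : 0 < N) :
    ((TT (8 * N : ℕ)).filter (fun x => CP x ∧ x.2.1 = x.2.2.2)).card =
    ∑ d ∈ N.divisors.filter (fun d => d % 8 = 3 ∨ d % 8 = 5), N / d := by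
  have : ∑ d ∈ N.divisors.filter (fun d => d % 8 = 3 ∨ d % 8 = 5), N / d =
      ((N.divisors.filter (fun d => d % 8 = 3 ∨ d % 8 = 5)).sigma (fun d => Finset.range (N / d))).card := by
    rw [Finset.card_sigma]; simp
  rw [this]
  refine Finset.card_nbij' (fun x => ⟨x.2.1.toNat, (x.1 / 8).toNat⟩)
    (fun s => (8 * (s.2 : ℤ) + (if s.1 % 8 = 3 then 1 else 7), (s.1 : ℤ),
      8 * ((N / s.1 : ℕ) : ℤ) - (8 * (s.2 : ℤ) + (if s.1 % 8 = 3 then 1 else 7)), (s.1 : ℤ))) ?_ ?_ ?_ ?_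
  · rintro ⟨a, d, b, e⟩ h
    simp only [Finset.coe_filter, Set.mem_ofPred_eq, mem_TT, CP] at h
    obtain ⟨⟨h1, h2, h3, h4, h5⟩, h6, rfl⟩ := h
    lift d to ℕ using h2.le
    obtain ⟨c, hc⟩ : (8 : ℤ) ∣ a + b := by omega
    have hN' : (N : ℤ) = d * c := by
      push_cast at h5
      have : 8 * (N : ℤ) = 8 * (d * c) := by linear_combination -h5 + d * hc
      linarith
    have hc0 : 0 < c := by omega
    lift c to ℕ using hc0.le
    have hN'' : N = d * c := by exact_mod_cast hN'
    simp only [Finset.coe_sigma, Set.mem_sigma_iff, Finset.coe_filter, Set.mem_ofPred_eq,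
      Nat.mem_divisors, Finset.coe_range, Set.mem_Iio, Int.toNat_natCast]
    have : N / d = c := by rw [hN'', Nat.mul_div_cancel_left _ (by omega)]
    rw [this]
    refine ⟨⟨⟨⟨c, hN''⟩, by omega⟩, by omega⟩, by omega⟩
  · rintro ⟨d, i⟩ h
    simp only [Finset.coe_sigma, Set.mem_sigma_iff, Finset.coe_filter, Set.mem_ofPred_eq,
      Nat.mem_divisors, Finset.coe_range, Set.mem_Iio] at h
    obtain ⟨⟨⟨⟨c, rfl⟩, _⟩, h2⟩, h3⟩ := h
    rw [Nat.mul_div_cancel_left _ (by omega)] at h3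
    simp only [Finset.coe_filter, Set.mem_ofPred_eq, mem_TT, CP]
    rw [Nat.mul_div_cancel_left _ (by omega)]
    refine ⟨⟨by split_ifs <;> omega, by omega, by split_ifs <;> omega, by omega, by push_cast; ring⟩, ?_, trivial⟩
    split_ifs <;> omega
  · rintro ⟨a, d, b, e⟩ h
    simp only [Finset.coe_filter, Set.mem_ofPred_eq, mem_TT, CP] at h
    obtain ⟨⟨h1, h2, h3, h4, h5⟩, h6, rfl⟩ := h
    lift d to ℕ using h2.le
    obtain ⟨c, hc⟩ : (8 : ℤ) ∣ a + b := by omega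
    have hN' : (N : ℤ) = d * c := by
      push_cast at h5
      have : 8 * (N : ℤ) = 8 * (d * c) := by linear_combination -h5 + d * hc
      linarith
    have hc0 : 0 < c := by omega
    lift c to ℕ using hc0.le
    have hN'' : N = d * c := by exact_mod_cast hN'
    have : N / d = c := by rw [hN'', Nat.mul_div_cancel_left _ (by omega)]
    simp only [Int.toNat_natCast, this, Prod.mk.injEq]
    refine ⟨?_, trivial, ?_, trivial⟩ <;> split_ifs <;> omega
  · rintro ⟨d, i⟩ h
    simp only [Int.toNat_natCast]
    congr 1
    split_ifs <;> omega

lemma M_diag (N : ℕ) (hN : 0 < N) :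
    ((TT (8 * N : ℕ)).filter (fun x => CM x ∧ x.1 = x.2.2.1)).card =
    ∑ d ∈ N.divisors.filter (fun d => d % 8 = 1 ∨ d % 8 = 7), N / d := by
  have : ∑ d ∈ N.divisors.filter (fun d => d % 8 = 1 ∨ d % 8 = 7), N / d =
      ((N.divisors.filter (fun d => d % 8 = 1 ∨ d % 8 = 7)).sigma (fun d => Finset.range (N / d))).card := by
    rw [Finset.card_sigma]; simp
  rw [this]
  refine Finset.card_nbij' (fun x => ⟨x.1.toNat, (x.2.1 / 8).toNat⟩)
    (fun s => ((s.1 : ℤ), 8 * (s.2 : ℤ) + (if s.1 % 8 = 1 then 3 else 5), (s.1 : ℤ),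
      8 * ((N / s.1 : ℕ) : ℤ) - (8 * (s.2 : ℤ) + (if s.1 % 8 = 1 then 3 else 5)))) ?_ ?_ ?_ ?_
  · rintro ⟨d, a, e, b⟩ h
    simp only [Finset.coe_filter, Set.mem_ofPred_eq, mem_TT, CM] at h
    obtain ⟨⟨h1, h2, h3, h4, h5⟩, h6, rfl⟩ := h
    lift d to ℕ using h1.le
    obtain ⟨c, hc⟩ : (8 : ℤ) ∣ a + b := by omega
    have hN' : (N : ℤ) = d * c := by
      push_cast at h5
      have : 8 * (N : ℤ) = 8 * (d * c) := by linear_combination -h5 + d * hc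
      linarith
    have hc0 : 0 < c := by omega
    lift c to ℕ using hc0.le
    have hN'' : N = d * c := by exact_mod_cast hN'
    simp only [Finset.coe_sigma, Set.mem_sigma_iff, Finset.coe_filter, Set.mem_ofPred_eq,
      Nat.mem_divisors, Finset.coe_range, Set.mem_Iio, Int.toNat_natCast]
    have : N / d = c := by rw [hN'', Nat.mul_div_cancel_left _ (by omega)]
    rw [this]
    refine ⟨⟨⟨⟨c, hN''⟩, by omega⟩, by omega⟩, by omega⟩
  · rintro ⟨d, i⟩ h
    simp only [Finset.coe_sigma, Set.mem_sigma_iff, Finset.coe_filter, Set.mem_ofPred_eq,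
      Nat.mem_divisors, Finset.coe_range, Set.mem_Iio] at h
    obtain ⟨⟨⟨⟨c, rfl⟩, _⟩, h2⟩, h3⟩ := h
    rw [Nat.mul_div_cancel_left _ (by omega)] at h3
    simp only [Finset.coe_filter, Set.mem_ofPred_eq, mem_TT, CM]
    rw [Nat.mul_div_cancel_left _ (by omega)]
    refine ⟨⟨by omega, by split_ifs <;> omega, by omega, by split_ifs <;> omega, by push_cast; ring⟩, ?_, trivial⟩
    split_ifs <;> omega
  · rintro ⟨d, a, e, b⟩ h
    simp only [Finset.coe_filter, Set.mem_ofPred_eq, mem_TT, CM] at h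
    obtain ⟨⟨h1, h2, h3, h4, h5⟩, h6, rfl⟩ := h
    lift d to ℕ using h1.le
    obtain ⟨c, hc⟩ : (8 : ℤ) ∣ a + b := by omega
    have hN' : (N : ℤ) = d * c := by
      push_cast at h5
      have : 8 * (N : ℤ) = 8 * (d * c) := by linear_combination -h5 + d * hc
      linarith
    have hc0 : 0 < c := by omega
    lift c to ℕ using hc0.le
    have hN'' : N = d * c := by exact_mod_cast hN'
    have : N / d = c := by rw [hN'', Nat.mul_div_cancel_left _ (by omega)]
    simp only [Int.toNat_natCast, this, Prod.mk.injEq]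
    refine ⟨trivial, ?_, trivial, ?_⟩ <;> split_ifs <;> omega
  · rintro ⟨d, i⟩ h
    simp only [Int.toNat_natCast]
    congr 1
    split_ifs <;> omega

lemma MP (N : ℕ) (hN : 0 < N) :
    (((TT (8 * N : ℕ)).filter CM).card : ℤ) - ((TT (8 * N : ℕ)).filter CP).card =
    ∑ d ∈ N.divisors, c8 d * (N / d : ℕ) := by
  have h1 := P_diag N hN
  have h2 := M_diag N hN
  have h3 := P_eq (8 * N : ℕ)
  have h4 := M_eq (8 * N : ℕ)
  have h5 := U_eq' (8 * N : ℕ)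
  have e1 := Finset.card_filter_add_card_filter_not (s := (TT (8 * N : ℕ)).filter CP) (fun x => x.2.1 = x.2.2.2)
  have e2 := Finset.card_filter_add_card_filter_not (s := (TT (8 * N : ℕ)).filter CM) (fun x => x.1 = x.2.2.1)
  rw [Finset.filter_filter, Finset.filter_filter] at e1 e2
  have : ∑ d ∈ N.divisors, c8 d * (N / d : ℕ) =
    ((∑ d ∈ N.divisors.filter (fun d => d % 8 = 1 ∨ d % 8 = 7), N / d : ℕ) : ℤ) -
    ((∑ d ∈ N.divisors.filter (fun d => d % 8 = 3 ∨ d % 8 = 5), N / d : ℕ) : ℤ) := by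
    rw [Finset.sum_filter, Finset.sum_filter]
    push_cast
    rw [← Finset.sum_sub_distrib]
    refine Finset.sum_congr rfl fun d _ => ?_
    unfold c8
    split_ifs <;> first | omega | simp
  rw [this]
  simp only [ne_eq] at h3 h4
  omega

lemma liou_pt (a d b e N : ℤ) (hx : a * d + b * e = 8 * N) :
    -4 * (if (a * d) % 8 = 3 then uu d * uu e else 0) =
    4 * ((if CM (a, d, b, e) then 1 else 0) - (if CP (a, d, b, e) then 1 else 0)) := by
  simp only [CM, CP, uu]
  by_cases hd : d % 8 = 3 ∨ d % 8 = 5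
  · by_cases he : e % 8 = 3 ∨ e % 8 = 5
    · rcases hd with hd | hd <;> rcases he with he | he <;>
      · have h7 := mul_mod8 a d _ hd
        have h8 := mul_mod8 b e _ he
        generalize a * d = X at *
        generalize b * e = Y at *
        simp only [hd, he, and_true, true_and]
        norm_num
        split_ifs <;> first | rfl | (exfalso; omega)
    · have : ¬ e % 8 = 3 := by omega
      have : ¬ e % 8 = 5 := by omega
      simp [*]
  · have : ¬ d % 8 = 3 := by omega
    have : ¬ d % 8 = 5 := by omega
    simp [*]

lemma liou (N : ℕ) (hN : 0 < N) :
    ∑ LK ∈ Finset.HasAntidiagonal.antidiagonal (8 * N),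
      (if LK.1 % 8 = 3 then gs d8 LK.1 * gs c4 LK.2 else 0) =
    4 * ∑ d ∈ N.divisors, c8 d * (N / d : ℕ) := by
  rw [← MP N hN]
  have h2 : ∀ (f : ℤ → ℤ) L, gs f L = ∑ x ∈ L.divisorsAntidiagonal, f (x.2 : ℕ) := by
    intro f L; rw [Nat.sum_divisorsAntidiagonal' (fun _ d => f (d : ℤ))]; rfl
  have e := sum_TT (8 * N) (fun a d b e => if (a * d) % 8 = 3 then uu d * uu e else 0)
  have : ∑ LK ∈ Finset.HasAntidiagonal.antidiagonal (8 * N),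
      (if LK.1 % 8 = 3 then gs d8 LK.1 * gs c4 LK.2 else 0) = 
      -4 * ∑ x ∈ TT (8 * N : ℕ), (if (x.1 * x.2.1) % 8 = 3 then uu x.2.1 * uu x.2.2.2 else 0) := by
    rw [← e, Finset.mul_sum]
    refine Finset.sum_congr rfl fun LK h => ?_
    obtain ⟨L, K⟩ := LK
    simp only [Finset.HasAntidiagonal.mem_antidiagonal] at h
    by_cases hL : L % 8 = 3
    · simp only [hL, if_true]
      rw [gs_d8 L hL, gs_c4 K (by omega), h2, h2]
      have : ∀ x ∈ L.divisorsAntidiagonal, ∀ y ∈ K.divisorsAntidiagonal,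
          (if ((x.1 : ℤ) * (x.2 : ℤ)) % 8 = 3 then uu x.2 * uu y.2 else 0) = uu x.2 * uu y.2 := by
        intro x hx y hy
        rw [if_pos]
        have := (Nat.mem_divisorsAntidiagonal.1 hx).1
        have h3 : (x.1 : ℤ) * (x.2 : ℤ) = L := by exact_mod_cast this
        omega
      rw [Finset.sum_congr rfl (fun x hx => Finset.sum_congr rfl (this x hx)), ← Finset.sum_mul_sum]
      ring
    · simp only [hL, if_false]
      rw [eq_comm, mul_eq_zero]; right
      refine Finset.sum_eq_zero fun x hx => Finset.sum_eq_zero fun y hy => ?_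
      rw [if_neg]
      have := (Nat.mem_divisorsAntidiagonal.1 hx).1
      have h3 : (x.1 : ℤ) * (x.2 : ℤ) = L := by exact_mod_cast this
      omega
  rw [this, Finset.card_filter, Finset.card_filter]
  push_cast
  rw [← Finset.sum_sub_distrib, Finset.mul_sum, Finset.mul_sum]
  refine Finset.sum_congr rfl fun x hx => ?_
  obtain ⟨a, d, b, e⟩ := x
  rw [mem_TT] at hx
  have hx := hx.2.2.2.2
  push_cast at hx
  exact liou_pt a d b e N hx

end liouville

section invol

def sg (x : ℤ) : ℤ := if x % 2 = 0 then 1 else -1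

noncomputable def XX (M : ℤ) : Finset (ℤ × ℤ × ℤ) :=
  (Finset.Icc ((-M, 1, 1) : ℤ × ℤ × ℤ) (M, M, M)).filter
    (fun x => x.1 % 2 = 1 ∧ x.2.1 % 2 = 1 ∧ x.1 ^ 2 + 8 * (x.2.1 * x.2.2) = M)

lemma mem_XX (M u d e : ℤ) : (u, d, e) ∈ XX M ↔
    u % 2 = 1 ∧ 0 < d ∧ d % 2 = 1 ∧ 0 < e ∧ u ^ 2 + 8 * (d * e) = M := by
  simp only [XX, Finset.mem_filter, Finset.mem_Icc, Prod.mk_le_mk]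
  constructor
  · rintro ⟨⟨⟨h1, h2, h3⟩, -⟩, h4, h5, h6⟩
    exact ⟨h4, by omega, h5, by omega, h6⟩
  · rintro ⟨h1, h2, h3, h4, h5⟩
    refine ⟨⟨⟨?_, by omega, by omega⟩, ?_, ?_, ?_⟩, h1, h3, h5⟩ <;>
    nlinarith [mul_pos h2 h4, sq_nonneg (u - 1), sq_nonneg (u + 1), sq_nonneg u]

lemma c4_neg (x : ℤ) : c4 (-x) = - c4 x := by
  unfold c4; split_ifs <;> omega

lemma sumW (M : ℤ) : ∑ x ∈ (XX M).filter (fun x => x.2.1 + x.1 < 2 * x.2.2), c4 x.2.1 * sg x.2.2 =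
    ∑ x ∈ (XX M).filter (fun x => x.2.1 - x.1 < 2 * x.2.2), c4 x.1 * sg x.2.2 := by
  refine Finset.sum_nbij' (fun x => (x.1 + 2 * x.2.1, x.2.1, x.2.2 - (x.2.1 + x.1) / 2))
    (fun x => (x.1 - 2 * x.2.1, x.2.1, x.2.2 + (x.1 - x.2.1) / 2)) ?_ ?_ ?_ ?_ ?_
  · rintro ⟨u, d, e⟩ h
    simp only [Finset.mem_filter, mem_XX] at h ⊢
    obtain ⟨⟨h1, h2, h3, h4, h5⟩, h6⟩ := h
    obtain ⟨s, hs⟩ : ∃ s, u = 2 * s - d := ⟨(u + d) / 2, by omega⟩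
    subst hs
    rw [show (d + (2 * s - d)) / 2 = s by omega]
    exact ⟨⟨by omega, h2, h3, by omega, by linear_combination h5⟩, by omega⟩
  · rintro ⟨u, d, e⟩ h
    simp only [Finset.mem_filter, mem_XX] at h ⊢
    obtain ⟨⟨h1, h2, h3, h4, h5⟩, h6⟩ := h
    obtain ⟨s, hs⟩ : ∃ s, u = 2 * s + d := ⟨(u - d) / 2, by omega⟩
    subst hs
    rw [show (2 * s + d - d) / 2 = s by omega]
    exact ⟨⟨by omega, h2, h3, by omega, by linear_combination h5⟩, by omega⟩
  · rintro ⟨u, d, e⟩ h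
    simp only [Prod.mk.injEq]
    refine ⟨by omega, trivial, by omega⟩
  · rintro ⟨u, d, e⟩ h
    simp only [Prod.mk.injEq]
    refine ⟨by omega, trivial, by omega⟩
  · rintro ⟨u, d, e⟩ h
    simp only [Finset.mem_filter, mem_XX] at h ⊢
    obtain ⟨⟨h1, h2, h3, h4, h5⟩, h6⟩ := h
    clear h5
    unfold c4 sg
    split_ifs <;> first | rfl | (exfalso; omega)

lemma sumR (M : ℤ) : ∑ x ∈ (XX M).filter (fun x => x.2.1 - x.1 < 2 * x.2.2), c4 x.1 * sg x.2.2 =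
    - ∑ x ∈ (XX M).filter (fun x => x.2.1 + x.1 < 2 * x.2.2), c4 x.1 * sg x.2.2 := by
  rw [← Finset.sum_neg_distrib]
  refine Finset.sum_nbij' (fun x => (-x.1, x.2.1, x.2.2)) (fun x => (-x.1, x.2.1, x.2.2)) ?_ ?_ ?_ ?_ ?_
  · rintro ⟨u, d, e⟩ h
    simp only [Finset.mem_filter, mem_XX] at h ⊢
    obtain ⟨⟨h1, h2, h3, h4, h5⟩, h6⟩ := h
    exact ⟨⟨by omega, h2, h3, h4, by linear_combination h5⟩, by omega⟩
  · rintro ⟨u, d, e⟩ h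
    simp only [Finset.mem_filter, mem_XX] at h ⊢
    obtain ⟨⟨h1, h2, h3, h4, h5⟩, h6⟩ := h
    exact ⟨⟨by omega, h2, h3, h4, by linear_combination h5⟩, by omega⟩
  · rintro ⟨u, d, e⟩ h; simp
  · rintro ⟨u, d, e⟩ h; simp
  · rintro ⟨u, d, e⟩ h
    simp only [c4_neg]; ring

lemma sumH (M : ℤ) : ∑ x ∈ XX M, c4 x.1 * sg x.2.2 = 0 := by
  have : ∑ x ∈ XX M, c4 x.1 * sg x.2.2 = - ∑ x ∈ XX M, c4 x.1 * sg x.2.2 := by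
    rw [← Finset.sum_neg_distrib]
    refine Finset.sum_nbij' (fun x => (-x.1, x.2.1, x.2.2)) (fun x => (-x.1, x.2.1, x.2.2)) ?_ ?_ ?_ ?_ ?_
    · rintro ⟨u, d, e⟩ h
      simp only [mem_XX] at h ⊢
      obtain ⟨h1, h2, h3, h4, h5⟩ := h
      exact ⟨by omega, h2, h3, h4, by linear_combination h5⟩
    · rintro ⟨u, d, e⟩ h
      simp only [mem_XX] at h ⊢
      obtain ⟨h1, h2, h3, h4, h5⟩ := h
      exact ⟨by omega, h2, h3, h4, by linear_combination h5⟩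
    · rintro ⟨u, d, e⟩ h; simp
    · rintro ⟨u, d, e⟩ h; simp
    · rintro ⟨u, d, e⟩ h
      simp only [c4_neg]; ring
  omega

noncomputable def YY (M : ℤ) : Finset (ℤ × ℤ × ℤ) :=
  (Finset.Icc ((-M, -M, -M) : ℤ × ℤ × ℤ) (M, M, M)).filter
    (fun x => x.1 % 2 = 1 ∧ x.2.1 % 2 = 1 ∧ x.2.2 % 2 = 1 ∧ -x.1 < x.2.1 ∧ x.2.1 < x.1 ∧
      x.2.2 ^ 2 + 4 * (x.1 ^ 2 - x.2.1 ^ 2) = M)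

lemma mem_YY (M s r v : ℤ) : (s, r, v) ∈ YY M ↔
    s % 2 = 1 ∧ r % 2 = 1 ∧ v % 2 = 1 ∧ -s < r ∧ r < s ∧ v ^ 2 + 4 * (s ^ 2 - r ^ 2) = M := by
  simp only [YY, Finset.mem_filter, Finset.mem_Icc, Prod.mk_le_mk]
  constructor
  · rintro ⟨-, h⟩
    exact h
  · intro h
    refine ⟨?_, h⟩
    obtain ⟨h1, h2, h3, h4, h5, h6⟩ := h
    have e : s ^ 2 - r ^ 2 = (s - r) * (s + r) := by ring
    have p : s ≤ (s - r) * (s + r) := by nlinarith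
    have q : v ≤ v ^ 2 := by nlinarith [sq_nonneg (v - 1), sq_nonneg v, Int.le_self_sq v]
    have q' : -v ≤ v ^ 2 := by nlinarith [Int.le_self_sq (-v)]
    have := sq_nonneg v
    rw [e] at h6
    generalize (s - r) * (s + r) = z at *
    refine ⟨⟨?_, ?_, ?_⟩, ?_, ?_, ?_⟩ <;> linarith

lemma sumY (M : ℤ) : ∑ x ∈ (YY M).filter (fun x => 2 * x.2.1 < x.2.2), c4 x.2.1 * c4 x.1 * c4 x.2.2 = 0 := by
  have h1 : ∑ x ∈ (YY M).filter (fun x => 2 * x.2.1 < x.2.2), c4 x.2.1 * c4 x.1 * c4 x.2.2 =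
      - ∑ x ∈ (YY M).filter (fun x => -(2 * x.2.1) < x.2.2), c4 x.2.1 * c4 x.1 * c4 x.2.2 := by
    rw [← Finset.sum_neg_distrib]
    refine Finset.sum_nbij' (fun x => (x.1, -x.2.1, x.2.2)) (fun x => (x.1, -x.2.1, x.2.2)) ?_ ?_ ?_ ?_ ?_
    · rintro ⟨s, r, v⟩ h
      simp only [Finset.mem_filter, mem_YY] at h ⊢
      obtain ⟨⟨h1, h2, h3, h4, h5, h6⟩, h7⟩ := h
      exact ⟨⟨h1, by omega, h3, by omega, by omega, by linear_combination h6⟩, by omega⟩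
    · rintro ⟨s, r, v⟩ h
      simp only [Finset.mem_filter, mem_YY] at h ⊢
      obtain ⟨⟨h1, h2, h3, h4, h5, h6⟩, h7⟩ := h
      exact ⟨⟨h1, by omega, h3, by omega, by omega, by linear_combination h6⟩, by omega⟩
    · rintro ⟨s, r, v⟩ h; simp
    · rintro ⟨s, r, v⟩ h; simp
    · rintro ⟨s, r, v⟩ h; simp only [c4_neg]; ring
  have h2 : ∑ x ∈ (YY M).filter (fun x => 2 * x.2.1 < x.2.2), c4 x.2.1 * c4 x.1 * c4 x.2.2 =
      - ∑ x ∈ (YY M).filter (fun x => ¬ -(2 * x.2.1) < x.2.2), c4 x.2.1 * c4 x.1 * c4 x.2.2 := by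
    rw [← Finset.sum_neg_distrib]
    refine Finset.sum_nbij' (fun x => (x.1, x.2.1, -x.2.2)) (fun x => (x.1, x.2.1, -x.2.2)) ?_ ?_ ?_ ?_ ?_
    · rintro ⟨s, r, v⟩ h
      simp only [Finset.mem_filter, mem_YY] at h ⊢
      obtain ⟨⟨h1, h2, h3, h4, h5, h6⟩, h7⟩ := h
      exact ⟨⟨h1, by omega, by omega, by omega, by omega, by linear_combination h6⟩, by omega⟩
    · rintro ⟨s, r, v⟩ h
      simp only [Finset.mem_filter, mem_YY] at h ⊢
      obtain ⟨⟨h1, h2, h3, h4, h5, h6⟩, h7⟩ := h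
      exact ⟨⟨h1, by omega, by omega, by omega, by omega, by linear_combination h6⟩, by omega⟩
    · rintro ⟨s, r, v⟩ h; simp
    · rintro ⟨s, r, v⟩ h; simp
    · rintro ⟨s, r, v⟩ h; simp only [c4_neg]; ring
  have h3 : ∑ x ∈ YY M, c4 x.2.1 * c4 x.1 * c4 x.2.2 = - ∑ x ∈ YY M, c4 x.2.1 * c4 x.1 * c4 x.2.2 := by
    rw [← Finset.sum_neg_distrib]
    refine Finset.sum_nbij' (fun x => (x.1, x.2.1, -x.2.2)) (fun x => (x.1, x.2.1, -x.2.2)) ?_ ?_ ?_ ?_ ?_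
    · rintro ⟨s, r, v⟩ h
      simp only [mem_YY] at h ⊢
      obtain ⟨h1, h2, h3, h4, h5, h6⟩ := h
      exact ⟨h1, by omega, by omega, by omega, by omega, by linear_combination h6⟩
    · rintro ⟨s, r, v⟩ h
      simp only [mem_YY] at h ⊢
      obtain ⟨h1, h2, h3, h4, h5, h6⟩ := h
      exact ⟨h1, by omega, by omega, by omega, by omega, by linear_combination h6⟩
    · rintro ⟨s, r, v⟩ h; simp
    · rintro ⟨s, r, v⟩ h; simp
    · rintro ⟨s, r, v⟩ h; simp only [c4_neg]; ring
  have h4 := Finset.sum_filter_add_sum_filter_not (YY M) (fun x => -(2 * x.2.1) < x.2.2)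
    (fun x => c4 x.2.1 * c4 x.1 * c4 x.2.2)
  linarith

lemma par1 (s d : ℤ) (h3 : d % 2 = 1) (h7 : (2 * s - d - d) % 4 = 0) : s % 2 = 1 := by omega

lemma sumA (M : ℤ) : ∑ x ∈ (XX M).filter (fun x => 2 * x.2.2 < x.2.1 + x.1 ∧ (x.1 - x.2.1) % 4 = 0),
    c4 x.2.1 * sg x.2.2 = 0 := by
  refine Eq.trans ?_ (sumY M)
  refine Finset.sum_nbij' (fun x => ((x.1 + x.2.1) / 2, 2 * x.2.2 - (x.1 + x.2.1) / 2,
      x.2.1 + 2 * (2 * x.2.2 - (x.1 + x.2.1) / 2)))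
    (fun x => (2 * x.1 - (x.2.2 - 2 * x.2.1), x.2.2 - 2 * x.2.1, (x.1 + x.2.1) / 2)) ?_ ?_ ?_ ?_ ?_
  · rintro ⟨u, d, e⟩ h
    simp only [Finset.mem_filter, mem_XX, mem_YY] at h ⊢
    obtain ⟨⟨h1, h2, h3, h4, h5⟩, h6, h7⟩ := h
    obtain ⟨s, hs⟩ : ∃ s, u = 2 * s - d := ⟨(u + d) / 2, by omega⟩
    subst hs
    rw [show (2 * s - d + d) / 2 = s by omega]
    have hs1 := par1 s d h3 h7
    clear h7
    exact ⟨⟨by omega, by omega, by omega, by omega, by omega, by linear_combination h5⟩, by omega⟩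
  · rintro ⟨s, r, v⟩ h
    simp only [Finset.mem_filter, mem_XX, mem_YY] at h ⊢
    obtain ⟨⟨h1, h2, h3, h4, h5, h6⟩, h7⟩ := h
    obtain ⟨e, he⟩ : ∃ e, r = 2 * e - s := ⟨(r + s) / 2, by omega⟩
    subst he
    rw [show (s + (2 * e - s)) / 2 = e by omega]
    exact ⟨⟨by omega, by omega, by omega, by omega, by linear_combination h6⟩, by omega, by clear h6 h7 h4 h5; omega⟩
  · rintro ⟨u, d, e⟩ h
    simp only [Finset.mem_filter, mem_XX] at h
    simp only [Prod.mk.injEq]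
    omega
  · rintro ⟨s, r, v⟩ h
    simp only [Finset.mem_filter, mem_YY] at h
    simp only [Prod.mk.injEq]
    omega
  · rintro ⟨u, d, e⟩ h
    simp only [Finset.mem_filter, mem_XX] at h ⊢
    obtain ⟨⟨h1, h2, h3, h4, h5⟩, h6, h7⟩ := h
    clear h5
    obtain ⟨s, hs⟩ : ∃ s, u = 2 * s - d := ⟨(u + d) / 2, by omega⟩
    subst hs
    rw [show (2 * s - d + d) / 2 = s by omega]
    have hs1 := par1 s d h3 h7
    clear h7 h6 h1 h2 h4
    have hc : c4 (2 * e - s) * c4 s = - sg e := by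
      unfold c4 sg; split_ifs <;> first | rfl | (exfalso; omega)
    have hd : c4 (d + 2 * (2 * e - s)) = - c4 d := by
      unfold c4; split_ifs <;> first | rfl | (exfalso; omega)
    rw [hc, hd]; ring

lemma sumG (M : ℤ) : ∑ x ∈ XX M, c4 x.2.1 * sg x.2.2 =
    ∑ x ∈ (XX M).filter (fun x => 2 * x.2.2 = x.2.1 + x.1 ∧ (x.1 - x.2.1) % 4 = 0), 2 * c4 (x.1 + 2 * x.2.1) := by
  have h1 := sumW M
  have h2 := sumR M
  have h3 := sumH M
  have h4 := sumA M
  have h5 : ∑ x ∈ XX M, c4 x.2.1 * sg x.2.2 = ∑ x ∈ XX M, (c4 x.2.1 * sg x.2.2 + c4 x.1 * sg x.2.2) := by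
    rw [Finset.sum_add_distrib, h3, add_zero]
  have h6 : ∑ x ∈ XX M, (c4 x.2.1 * sg x.2.2 + c4 x.1 * sg x.2.2) =
      ∑ x ∈ (XX M).filter (fun x => ¬ x.2.1 + x.1 < 2 * x.2.2), (c4 x.2.1 * sg x.2.2 + c4 x.1 * sg x.2.2) := by
    rw [← Finset.sum_filter_add_sum_filter_not (XX M) (fun x => x.2.1 + x.1 < 2 * x.2.2)]
    rw [add_eq_right, Finset.sum_add_distrib]
    linarith
  rw [h5, h6]
  have h7 : ∑ x ∈ (XX M).filter (fun x => ¬ x.2.1 + x.1 < 2 * x.2.2), (c4 x.2.1 * sg x.2.2 + c4 x.1 * sg x.2.2)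
    = 2 * ∑ x ∈ (XX M).filter (fun x => 2 * x.2.2 < x.2.1 + x.1 ∧ (x.1 - x.2.1) % 4 = 0),
    c4 x.2.1 * sg x.2.2 + ∑ x ∈ (XX M).filter (fun x => 2 * x.2.2 = x.2.1 + x.1 ∧ (x.1 - x.2.1) % 4 = 0), 2 * c4 (x.1 + 2 * x.2.1) := by
    rw [Finset.mul_sum, Finset.sum_filter, Finset.sum_filter, Finset.sum_filter, ← Finset.sum_add_distrib]
    refine Finset.sum_congr rfl ?_
    rintro ⟨u, d, e⟩ h
    rw [mem_XX] at h
    obtain ⟨h1, h2, h3, h4, h5⟩ := h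
    clear h5
    simp only
    by_cases hud : (u - d) % 4 = 0
    · have e1 : c4 u = c4 d := by unfold c4; split_ifs <;> first | rfl | (exfalso; omega)
      simp only [hud, and_true, e1]
      rcases lt_trichotomy (2 * e) (d + u) with i | i | i
      · rw [if_pos (by omega), if_pos i, if_neg (by omega)]; ring
      · have e2 : c4 (u + 2 * d) = - c4 d := by
          clear i
          unfold c4; split_ifs <;> first | rfl | (exfalso; omega)
        have e3 : sg e = -1 := by unfold sg; rw [if_neg (by omega)]
        rw [if_pos (by omega), if_neg (by omega), if_pos i, e2, e3]; ring
      · rw [if_neg (by omega), if_neg (by omega), if_neg (by omega)]; rfl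
    · have e1 : c4 u = - c4 d := by unfold c4; split_ifs <;> first | rfl | (exfalso; omega)
      simp [hud, e1]
  rw [h7, h4]; simp

lemma II_nsq (M : ℤ) (h : ∀ S : ℤ, 0 < S → S % 2 = 1 → M ≠ S ^ 2) :
    ∑ x ∈ XX M, c4 x.2.1 * sg x.2.2 = 0 := by
  rw [sumG]
  refine Finset.sum_eq_zero ?_
  rintro ⟨u, d, e⟩ hx
  simp only [Finset.mem_filter, mem_XX] at hx
  obtain ⟨⟨h1, h2, h3, h4, h5⟩, h6, h7⟩ := hx
  exfalso
  refine h (u + 2 * d) (by omega) (by omega) ?_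
  rw [← h5]; linear_combination (4 * d) * h6

lemma II_sq (S : ℤ) (hS : 0 < S) (hS' : S % 2 = 1) :
    1 + 2 * ∑ x ∈ XX (S ^ 2), c4 x.2.1 * sg x.2.2 = c4 S * S := by
  rw [sumG]
  have : ∑ x ∈ (XX (S ^ 2)).filter (fun x => 2 * x.2.2 = x.2.1 + x.1 ∧ (x.1 - x.2.1) % 4 = 0), 2 * c4 (x.1 + 2 * x.2.1)
      = ∑ i ∈ Finset.range ((S + 1) / 4).toNat, 2 * c4 S := by
    refine Finset.sum_nbij' (fun x => (x.2.2 / 2).toNat)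
      (fun i => (4 * (2 * (i : ℤ) + 1) - S, S - 2 * (2 * (i : ℤ) + 1), 2 * (i : ℤ) + 1)) ?_ ?_ ?_ ?_ ?_
    · rintro ⟨u, d, e⟩ hx
      simp only [Finset.mem_filter, mem_XX, Finset.mem_range] at hx ⊢
      obtain ⟨⟨h1, h2, h3, h4, h5⟩, h6, h7⟩ := hx
      have : u + 2 * d = S := by
        have : (u + 2 * d) ^ 2 = S ^ 2 := by rw [← h5]; linear_combination (-4 * d) * h6
        rcases sq_eq_sq_iff_eq_or_eq_neg.1 this with h | h <;> omega
      omega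
    · intro i hi
      simp only [Finset.mem_filter, mem_XX, Finset.mem_range] at hi ⊢
      exact ⟨⟨by omega, by omega, by omega, by omega, by ring⟩, by omega, by omega⟩
    · rintro ⟨u, d, e⟩ hx
      simp only [Finset.mem_filter, mem_XX, Finset.mem_range] at hx ⊢
      obtain ⟨⟨h1, h2, h3, h4, h5⟩, h6, h7⟩ := hx
      have : u + 2 * d = S := by
        have : (u + 2 * d) ^ 2 = S ^ 2 := by rw [← h5]; linear_combination (-4 * d) * h6
        rcases sq_eq_sq_iff_eq_or_eq_neg.1 this with h | h <;> omega
      simp only [Prod.mk.injEq]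
      omega
    · intro i hi
      simp only
      omega
    · rintro ⟨u, d, e⟩ hx
      simp only [Finset.mem_filter, mem_XX] at hx ⊢
      obtain ⟨⟨h1, h2, h3, h4, h5⟩, h6, h7⟩ := hx
      have : u + 2 * d = S := by
        have : (u + 2 * d) ^ 2 = S ^ 2 := by rw [← h5]; linear_combination (-4 * d) * h6
        rcases sq_eq_sq_iff_eq_or_eq_neg.1 this with h | h <;> omega
      rw [this]
  rw [this, Finset.sum_const, Finset.card_range, nsmul_eq_mul, Int.toNat_of_nonneg (by omega)]
  unfold c4
  split_ifs <;> omega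

end invol

section final
open PowerSeries (coeff)

lemma qs_odd (k : ℕ) (x : ℤ) : ∃ s : ℕ, qs k (2 * x + 1) = k * (8 * s + 1) := by
  obtain ⟨a, ha⟩ : ∃ a, (2 * x + 1).natAbs = 2 * a + 1 := ⟨(2 * x + 1).natAbs / 2, by omega⟩
  obtain ⟨b, hb⟩ : ∃ b, a * (a + 1) = 2 * b := (Nat.even_mul_succ_self a).two_dvd
  refine ⟨b, ?_⟩
  rw [qs, ha]
  congr 1
  linarith

noncomputable def JJ : PowerSeries ℤ := G (fun k : ℤ => qs 1 (4 * k + 1)) (fun k => 4 * k + 1)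

lemma qJ_FF : FF (fun k : ℤ => qs 1 (4 * k + 1)) := by
  apply FF_of_le
  intro x
  unfold qs
  have : x.natAbs ≤ (4 * x + 1).natAbs := by omega
  nlinarith [Nat.le_self_pow (n := 2) (by norm_num) (4*x+1).natAbs]

def Sup (m r : ℕ) (F : PowerSeries ℤ) : Prop := ∀ n, n % m ≠ r % m → coeff n F = 0

lemma Sup.mul {m r s : ℕ} {F H : PowerSeries ℤ} (h1 : Sup m r F) (h2 : Sup m s H) :
    Sup m (r + s) (F * H) := by
  intro n hn
  rw [PowerSeries.coeff_mul]
  refine Finset.sum_eq_zero ?_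
  rintro ⟨i, j⟩ hij
  rw [Finset.HasAntidiagonal.mem_antidiagonal] at hij
  simp only at hij ⊢
  by_cases hi : i % m = r % m
  · by_cases hj : j % m = s % m
    · exfalso; apply hn
      rw [← hij, Nat.add_mod, hi, hj, ← Nat.add_mod]
    · rw [h2 j hj, mul_zero]
  · rw [h1 i hi, zero_mul]

lemma Sup_tho (k : ℕ) : Sup 8 k (tho k) := by
  intro n hn
  refine coeff_G_zero fun a ha => hn ?_
  obtain ⟨s, hs⟩ := qs_odd k a
  rw [hs] at ha
  rw [← ha, show k * (8 * s + 1) = k + 8 * (k * s) by ring]; omega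

lemma Sup_tho4 (k : ℕ) : Sup 4 k (tho k) := by
  intro n hn
  exact Sup_tho k n (by omega)

lemma Sup_J : Sup 8 1 JJ := by
  intro n hn
  refine coeff_G_zero fun a ha => hn ?_
  obtain ⟨s, hs⟩ := qs_odd 1 (2 * a)
  rw [show 4 * a + 1 = 2 * (2 * a) + 1 by ring, hs] at ha
  omega

lemma Sup_th (m k : ℕ) : Sup m 0 (th (m * k)) := by
  intro n hn
  refine coeff_G_zero fun a ha => hn ?_
  rw [← ha, qs, mul_assoc]; simp

lemma finsum_one_ncard {α : Type} (s : Set α) : ∑ᶠ a ∈ s, (1 : ℤ) = s.ncard := by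
  by_cases h : s.Finite
  · rw [finsum_mem_eq_finite_toFinset_sum _ h, Set.ncard_eq_toFinset_card s h]; simp
  · rw [Set.Infinite.ncard h, finsum_mem_eq_zero_of_infinite]
    · rfl
    · convert h using 1
      simp [Function.support]

lemma coeff_12 (L : ℕ) : coeff L (th 1 * th 2) = (RS 2 1 L).ncard := by
  rw [th, th, G_mul (qs_FF 1 (by norm_num)) (qs_FF 2 (by norm_num)), coeff_G, ← finsum_one_ncard]
  have : {a : ℤ × ℤ | qs 1 a.1 + qs 2 a.2 = L} = RS 2 1 L := by
    ext a
    simp only [RS, Set.mem_ofPred_eq]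
    zify
    rw [qs_cast, qs_cast]
    push_cast
    constructor <;> intro h <;> linear_combination h
  rw [this]; simp

lemma coeff_11 (L : ℕ) : coeff L (th 1 * th 1) = (RS 1 1 L).ncard := by
  rw [th, G_mul (qs_FF 1 (by norm_num)) (qs_FF 1 (by norm_num)), coeff_G, ← finsum_one_ncard]
  have : {a : ℤ × ℤ | qs 1 a.1 + qs 1 a.2 = L} = RS 1 1 L := by
    ext a
    simp only [RS, Set.mem_ofPred_eq]
    zify
    rw [qs_cast, qs_cast]
    push_cast
    constructor <;> intro h <;> linear_combination h
  rw [this]; simp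

lemma c3 (L : ℕ) (hL : L % 8 = 3) : coeff L (tho 1 * tho 2) = 2 * gs d8 L := by
  rw [← r12_count L (by omega), ← coeff_12, th_split 1 (by norm_num), th_split 2 (by norm_num)]
  norm_num
  have e1 := ((Sup_tho4 1).mul (Sup_th 4 2)) L (by omega)
  have e2 := ((Sup_th 4 1).mul (Sup_tho4 2)) L (by omega)
  have e3 := ((Sup_th 4 1).mul (Sup_th 4 2)) L (by omega)
  norm_num at e1 e2 e3
  rw [add_mul, mul_add, mul_add]
  simp only [map_add, e1, e2, e3]; ring

lemma c5 (L : ℕ) (hL : L % 8 = 5) : coeff L (tho 1 * tho 4) = 2 * gs c4 L := by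
  have h := r2_count L (by omega)
  rw [← coeff_11, th_split 1 (by norm_num)] at h
  norm_num at h
  have e1 := ((Sup_tho4 1).mul (Sup_tho4 1)) L (by omega)
  have e3 := ((Sup_th 4 1).mul (Sup_th 4 1)) L (by omega)
  have e4 := ((Sup_tho 1).mul (Sup_th 8 2)) L (by omega)
  norm_num at e1 e3 e4
  have e5 : (tho 1 + th 4) * (tho 1 + th 4) = tho 1 * tho 1 + th 4 * th 4 + tho 1 * th 4 + tho 1 * th 4 := by ring
  have e6 : tho 1 * th 4 = tho 1 * tho 4 + tho 1 * th 16 := by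
    rw [th_split 4 (by norm_num)]; ring
  rw [e5] at h
  simp only [map_add, e1, e3, e6, e4] at h
  linarith

lemma scale8 (N : ℕ) : coeff (8 * N) ((tho 8 * th 8) * (th 16 * th 32)) =
    coeff N ((tho 1 * th 1) * (th 2 * th 4)) := by
  unfold tho th
  have f1 := qs_FF 1 (by norm_num)
  have f2 := qs_FF 2 (by norm_num)
  have f4 := qs_FF 4 (by norm_num)
  have f8 := qs_FF 8 (by norm_num)
  have f16 := qs_FF 16 (by norm_num)
  have f32 := qs_FF 32 (by norm_num)
  have g1 := qso_FF 1 (by norm_num)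
  have g8 := qso_FF 8 (by norm_num)
  rw [G_mul g8 f8, G_mul f16 f32, G_mul (g8.prod f8) (f16.prod f32),
    G_mul g1 f1, G_mul f2 f4, G_mul (g1.prod f1) (f2.prod f4), ← coeff_G_scale _ _ 8 N (by norm_num)]
  congr 2
  funext p
  unfold qs
  ring

lemma scale2 (N : ℕ) : coeff (2 * N) ((tho 2 * th 8) * (tho 4 * tho 8)) =
    coeff N ((tho 1 * th 4) * (tho 2 * tho 4)) := by
  unfold tho th
  have f4 := qs_FF 4 (by norm_num)
  have f8 := qs_FF 8 (by norm_num)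
  have g1 := qso_FF 1 (by norm_num)
  have g2 := qso_FF 2 (by norm_num)
  have g4 := qso_FF 4 (by norm_num)
  have g8 := qso_FF 8 (by norm_num)
  rw [G_mul g2 f8, G_mul g4 g8, G_mul (g2.prod f8) (g4.prod g8),
    G_mul g1 f4, G_mul g2 g4, G_mul (g1.prod f4) (g2.prod g4), ← coeff_G_scale _ _ 2 N (by norm_num)]
  congr 2
  funext p
  unfold qs
  ring

lemma stepI (N : ℕ) (hN : N % 4 = 3) : coeff N (tho 1 * tho 2 * (th 4 * th 4)) =
    2 * ∑ d ∈ N.divisors, c8 d * (N / d : ℕ) := by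
  have a1 := tho_sq 1 (by norm_num)
  have a2 := tho_sq 2 (by norm_num)
  have a4 := tho_sq 4 (by norm_num)
  norm_num at a1 a2 a4
  have e : (tho 1 * tho 2) * (tho 1 * tho 4) = (8 : ℤ) • ((tho 8 * th 8) * (th 16 * th 32)) := by
    rw [zsmul_eq_mul]; push_cast
    linear_combination tho 2 * tho 4 * a1 + 2 * th 8 * tho 4 * a2 + 4 * th 8 * th 16 * a4
  have e' := congrArg (coeff (8 * N)) e
  rw [map_zsmul, scale8, PowerSeries.coeff_mul] at e'
  have l := liou N (by omega)
  have s : ∑ p ∈ Finset.HasAntidiagonal.antidiagonal (8 * N), coeff p.1 (tho 1 * tho 2) * coeff p.2 (tho 1 * tho 4)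
      = 4 * ∑ LK ∈ Finset.HasAntidiagonal.antidiagonal (8 * N),
      (if LK.1 % 8 = 3 then gs d8 LK.1 * gs c4 LK.2 else 0) := by
    rw [Finset.mul_sum]
    refine Finset.sum_congr rfl ?_
    rintro ⟨L, K⟩ h
    rw [Finset.HasAntidiagonal.mem_antidiagonal] at h
    simp only at h ⊢
    split_ifs with hL
    · rw [c3 L hL, c5 K (by omega)]; ring
    · rw [(Sup_tho 1).mul (Sup_tho 2) L (by omega)]; ring
  rw [s, l] at e'
  have b1 := th_split 1 (by norm_num)
  have b2 := th_split 2 (by norm_num)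
  norm_num at b1 b2
  have x : (tho 1 * th 1) * (th 2 * th 4) = tho 1 * tho 2 * (th 4 * th 4) + (tho 1 * tho 1) * (tho 2 * th 4)
      + (tho 1 * tho 1) * (th 8 * th 4) + (tho 1 * th 4) * (th 8 * th 4) := by
    rw [b1, b2]; ring
  have x1 := ((Sup_tho4 1).mul (Sup_tho4 1)).mul ((Sup_tho4 2).mul (Sup_th 4 1)) N (by omega)
  have x2 := ((Sup_tho4 1).mul (Sup_tho4 1)).mul ((Sup_th 4 2).mul (Sup_th 4 1)) N (by omega)
  have x3 := ((Sup_tho4 1).mul (Sup_th 4 1)).mul ((Sup_th 4 2).mul (Sup_th 4 1)) N (by omega)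
  norm_num at x1 x2 x3
  rw [x] at e'
  simp only [map_add, x1, x2, x3, smul_eq_mul] at e'
  linarith

lemma sum_c8 (N : ℕ) (hN : N % 2 = 1) : ∑ d ∈ N.divisors, c8 d * (N / d : ℕ) =
    c8 N * ∑ d ∈ N.divisors, (d : ℤ) * jacobiSym 2 d := by
  rw [← Nat.sum_div_divisors N (fun d => (d : ℤ) * jacobiSym 2 d), Finset.mul_sum]
  refine Finset.sum_congr rfl fun d hd => ?_
  obtain ⟨e, rfl⟩ := Nat.dvd_of_mem_divisors hd
  have hd0 : 0 < d := Nat.pos_of_mem_divisors hd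
  rw [Nat.mul_div_cancel_left _ hd0]
  have ho : e % 2 = 1 := by
    rcases Nat.mod_two_eq_zero_or_one e with h | h
    · rw [Nat.mul_mod, h] at hN; simp at hN
    · exact h
  rw [jacobiSym.at_two (Nat.odd_iff.2 ho)]
  have h8 : ZMod.χ₈ (e : ZMod 8) = c8 e := by
    rw [ZMod.χ₈_nat_eq_if_mod_eight, c8]; split_ifs <;> omega
  have hsq : c8 e * c8 e = 1 := by
    unfold c8; split_ifs <;> first | rfl | (exfalso; omega)
  rw [h8]
  push_cast
  rw [c8_mul]
  linear_combination (-(c8 d) * e) * hsq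

lemma t_coeff (n : ℕ) : (t 1 1 4 8 n : ℤ) = coeff (2 * (4 * n + 7)) ((tho 1 * tho 1) * (tho 4 * tho 8)) := by
  unfold tho
  have g1 := qso_FF 1 (by norm_num)
  have g4 := qso_FF 4 (by norm_num)
  have g8 := qso_FF 8 (by norm_num)
  rw [G_mul g1 g1, G_mul g4 g8, G_mul (g1.prod g1) (g4.prod g8), coeff_G, t, ← finsum_one_ncard]
  refine finsum_mem_eq_of_bijOn (fun P : ℤ × ℤ × ℤ × ℤ => ((P.1 - 1, P.2.1 - 1), (P.2.2.1 - 1, P.2.2.2 - 1))) ?_ ?_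
  · have key : ∀ x : ℤ, (2 * (x - 1) + 1) ^ 2 = 8 * (x * (x - 1) / 2) + 1 := by
      intro x
      obtain ⟨y, hy⟩ : (2 : ℤ) ∣ x * (x - 1) := by
        rcases Int.even_or_odd' x with ⟨k, rfl | rfl⟩
        · exact ⟨k * (2 * k - 1), by ring⟩
        · exact ⟨(2 * k + 1) * k, by ring⟩
      rw [hy, Int.mul_ediv_cancel_left _ (by norm_num)]
      linear_combination 4 * hy
    have hiff : ∀ x y z w : ℤ, (qs 1 (2 * (x - 1) + 1) + qs 1 (2 * (y - 1) + 1) +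
        (qs 4 (2 * (z - 1) + 1) + qs 8 (2 * (w - 1) + 1)) = 2 * (4 * n + 7)) ↔
        (n : ℤ) = (1 : ℕ) * (x * (x - 1) / 2) + (1 : ℕ) * (y * (y - 1) / 2)
      + (4 : ℕ) * (z * (z - 1) / 2) + (8 : ℕ) * (w * (w - 1) / 2) := by
      intro x y z w
      zify
      simp only [qs_cast, key]
      push_cast
      constructor <;> intro h <;> linarith
    refine ⟨?_, ?_, ?_⟩
    · rintro ⟨x, y, z, w⟩ h
      exact (hiff x y z w).2 h
    · rintro ⟨x, y, z, w⟩ _ ⟨x', y', z', w'⟩ _ h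
      simpa [and_assoc] using h
    · rintro ⟨⟨x, y⟩, z, w⟩ h
      refine ⟨(x + 1, y + 1, z + 1, w + 1), (hiff _ _ _ _).1 ?_, by simp⟩
      simpa using h
  · intro _ _; simp

lemma sg_mul (x y : ℤ) (hx : x % 2 = 1) : sg (x * y) = sg y := by
  obtain ⟨k, hk⟩ : ∃ k, x = 2 * k + 1 := ⟨x / 2, by omega⟩
  subst hk
  have : (2 * k + 1) * y = y + 2 * (k * y) := by ring
  rw [this]
  generalize k * y = z
  unfold sg; split_ifs <;> omega

def qE (p : ℕ × ℕ) : ℕ := 8 * ((2 * p.1 + 1) * (p.2 + 1))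
def wE (p : ℕ × ℕ) : ℤ := c4 (2 * p.1 + 1) * sg (p.2 + 1)

lemma qE_FF : FF qE := by
  intro n
  refine Set.Finite.subset (Set.finite_Icc ((0, 0) : ℕ × ℕ) (n, n)) ?_
  rintro ⟨i, j⟩ h
  have h : 8 * ((2 * i + 1) * (j + 1)) = n := h
  simp only [Set.mem_Icc, Prod.mk_le_mk]
  refine ⟨⟨by omega, by omega⟩, ?_, ?_⟩ <;> nlinarith

lemma coeff_E (m : ℕ) (hm : 0 < m) : coeff (8 * m) (G qE wE) = sg m * gs c4 m := by
  rw [coeff_G, finsum_mem_eq_finite_toFinset_sum _ (qE_FF _), gs, Finset.mul_sum]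
  have : ∑ d ∈ m.divisors, sg m * c4 d = ∑ d ∈ m.divisors.filter (fun d => d % 2 = 1), sg m * c4 d := by
    rw [Finset.sum_filter]
    refine Finset.sum_congr rfl fun d _ => ?_
    split_ifs with h
    · rfl
    · have : c4 d = 0 := by unfold c4; split_ifs <;> first | rfl | (exfalso; omega)
      rw [this, mul_zero]
  rw [this]
  refine Finset.sum_nbij' (fun p => 2 * p.1 + 1) (fun d => (d / 2, m / d - 1)) ?_ ?_ ?_ ?_ ?_
  · rintro ⟨i, j⟩ h
    simp only [Set.Finite.mem_toFinset, Set.mem_ofPred_eq, qE] at h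
    simp only [Finset.mem_filter, Nat.mem_divisors]
    exact ⟨⟨⟨j + 1, by omega⟩, by omega⟩, by omega⟩
  · intro d h
    simp only [Finset.mem_filter, Nat.mem_divisors] at h
    obtain ⟨⟨⟨e, rfl⟩, h1⟩, h2⟩ := h
    rw [Nat.mul_div_cancel_left _ (by omega)]
    simp only [Set.Finite.mem_toFinset, Set.mem_ofPred_eq, qE]
    have : 0 < e := Nat.pos_of_mul_pos_left hm
    rw [show 2 * (d / 2) + 1 = d by omega, show e - 1 + 1 = e by omega]
  · rintro ⟨i, j⟩ h
    simp only [Set.Finite.mem_toFinset, Set.mem_ofPred_eq, qE] at h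
    have : m = (2 * i + 1) * (j + 1) := by omega
    subst this
    rw [Nat.mul_div_cancel_left _ (by omega)]
    simp only [Prod.mk.injEq]; omega
  · intro d h
    simp only [Finset.mem_filter, Nat.mem_divisors] at h ⊢
    omega
  · rintro ⟨i, j⟩ h
    simp only [Set.Finite.mem_toFinset, Set.mem_ofPred_eq, qE] at h
    have : (m : ℤ) = (2 * (i : ℤ) + 1) * ((j : ℤ) + 1) := by
      have : m = (2 * i + 1) * (j + 1) := by omega
      rw [this]; push_cast; ring
    rw [this, sg_mul _ _ (by omega), wE]
    push_cast; ring

lemma sg_sq (x y : ℤ) : sg x * sg y = sg (x ^ 2 + y ^ 2) := by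
  have h : ∀ x : ℤ, x ^ 2 % 2 = x % 2 := by
    intro x
    rcases Int.even_or_odd' x with ⟨k, rfl | rfl⟩
    · rw [show (2 * k) ^ 2 = 2 * (2 * k ^ 2) by ring]; omega
    · rw [show (2 * k + 1) ^ 2 = 2 * (2 * k ^ 2 + 2 * k) + 1 by ring]; omega
  have h1 := h x
  have h2 := h y
  generalize x ^ 2 = a at *
  generalize y ^ 2 = b at *
  unfold sg
  split_ifs <;> first | rfl | (exfalso; omega)

lemma Sup_ths8 : Sup 8 0 (ths 8) := by
  intro n hn
  refine coeff_G_zero fun a ha => hn ?_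
  rw [← ha, qs]; simp

lemma ths_eq : ths 8 * ths 8 = 1 + 4 * G qE wE := by
  have f8 := qs_FF 8 (by norm_num)
  have c4' : (4 : PowerSeries ℤ) = PowerSeries.C 4 := by simp
  ext n
  rw [map_add, c4', PowerSeries.coeff_C_mul, PowerSeries.coeff_one]
  by_cases hn : 8 ∣ n
  · obtain ⟨m, rfl⟩ := hn
    have h1 : coeff (8 * m) (ths 8 * ths 8) = sg m * (RS 1 1 m).ncard := by
      rw [ths, G_mul f8 f8, coeff_G, ← finsum_one_ncard]
      have : {a : ℤ × ℤ | qs 8 a.1 + qs 8 a.2 = 8 * m} = RS 1 1 m := by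
        ext a
        simp only [RS, Set.mem_ofPred_eq]
        zify
        rw [qs_cast, qs_cast]
        push_cast
        constructor <;> intro h <;> linarith
      have hf : (RS 1 1 m).Finite := by rw [← this]; exact f8.prod f8 _
      rw [this, finsum_mem_eq_finite_toFinset_sum _ hf, finsum_mem_eq_finite_toFinset_sum _ hf,
        Finset.mul_sum]
      refine Finset.sum_congr rfl ?_
      rintro ⟨x, y⟩ h
      simp only [Set.Finite.mem_toFinset, RS, Set.mem_ofPred_eq] at h
      change sg x * sg y = sg m * 1
      rw [sg_sq, mul_one]
      congr 1
      linarith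
    rw [h1]
    rcases Nat.eq_zero_or_pos m with rfl | hm
    · have hr : RS 1 1 0 = {(0, 0)} := by
        ext ⟨x, y⟩
        simp only [RS, Set.mem_ofPred_eq, Set.mem_singleton_iff, Prod.mk.injEq]
        constructor
        · intro h
          constructor <;> nlinarith [sq_nonneg x, sq_nonneg y]
        · rintro ⟨rfl, rfl⟩; norm_num
      have hz : coeff (8 * 0) (G qE wE) = 0 := by
        refine coeff_G_zero ?_
        rintro ⟨i, j⟩ h
        have h : 8 * ((2 * i + 1) * (j + 1)) = 0 := by simpa [qE] using h
        nlinarith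
      rw [hz]
      have : ((0 : ℕ) : ℤ) = 0 := rfl
      simp only [Nat.cast_zero, hr]
      simp [sg]
    · rw [coeff_E m hm, r2_count m hm, if_neg (by omega)]; ring
  · have z1 := (Sup_ths8.mul Sup_ths8) n (by omega)
    have z2 : coeff n (G qE wE) = 0 := by
      refine coeff_G_zero ?_
      rintro ⟨i, j⟩ h
      exact hn ⟨_, h.symm⟩
    rw [z1, z2, if_neg (by omega)]; ring

lemma coeff_thoE (M : ℕ) : coeff M (tho 1 * G qE wE) = ∑ x ∈ XX M, c4 x.2.1 * sg x.2.2 := by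
  have g1 := qso_FF 1 (by norm_num)
  rw [tho, G_mul g1 qE_FF, coeff_G, ← finsum_mem_coe_finset]
  refine finsum_mem_eq_of_bijOn
    (fun p : ℤ × ℕ × ℕ => (2 * p.1 + 1, 2 * (p.2.1 : ℤ) + 1, (p.2.2 : ℤ) + 1)) ?_ ?_
  · have hiff : ∀ (x : ℤ) (i j : ℕ), qs 1 (2 * x + 1) + qE (i, j) = M ↔
        (2 * x + 1) ^ 2 + 8 * ((2 * (i : ℤ) + 1) * ((j : ℤ) + 1)) = M := by
      intro x i j
      zify
      rw [qs_cast, qE]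
      push_cast
      rw [one_mul]
    refine ⟨?_, ?_, ?_⟩
    · rintro ⟨x, i, j⟩ h
      have h := (hiff x i j).1 h
      rw [Finset.mem_coe, mem_XX]
      exact ⟨by omega, by omega, by omega, by omega, h⟩
    · rintro ⟨x, i, j⟩ _ ⟨x', i', j'⟩ _ h
      simpa using h
    · rintro ⟨u, d, e⟩ h
      rw [Finset.mem_coe, mem_XX] at h
      obtain ⟨h1, h2, h3, h4, h5⟩ := h
      obtain ⟨x, rfl⟩ : ∃ x, u = 2 * x + 1 := ⟨u / 2, by omega⟩
      obtain ⟨i, rfl⟩ : ∃ i : ℕ, d = 2 * (i : ℤ) + 1 := ⟨(d / 2).toNat, by omega⟩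
      obtain ⟨j, rfl⟩ : ∃ j : ℕ, e = (j : ℤ) + 1 := ⟨(e - 1).toNat, by omega⟩
      exact ⟨(x, i, j), (hiff x i j).2 h5, rfl⟩
  · rintro ⟨x, i, j⟩ _
    simp [wE]

lemma stepII : tho 1 * (ths 8 * ths 8) = 2 * JJ := by
  have hc : ∀ c : ℤ, (c : PowerSeries ℤ) = PowerSeries.C c := by intro c; simp
  have e : tho 1 * (ths 8 * ths 8) = tho 1 + PowerSeries.C 4 * (tho 1 * G qE wE) := by
    rw [ths_eq, ← hc]; push_cast; ring
  have e2 : (2 : PowerSeries ℤ) * JJ = PowerSeries.C 2 * JJ := by rw [← hc]; push_cast; ring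
  rw [e, e2]
  ext M
  rw [map_add, PowerSeries.coeff_C_mul, PowerSeries.coeff_C_mul, coeff_thoE]
  have q1 : ∀ x : ℤ, qs 1 x = M ↔ x ^ 2 = M := by
    intro x; zify; rw [qs_cast]; push_cast; rw [one_mul]
  by_cases h : ∃ S : ℤ, 0 < S ∧ S % 2 = 1 ∧ (M : ℤ) = S ^ 2
  · obtain ⟨S, h1, h2, h3⟩ := h
    have h4 := II_sq S h1 h2
    rw [← h3] at h4
    have c1 : coeff M (tho 1) = 2 := by
      rw [tho, coeff_G, finsum_one_ncard]
      have : {x : ℤ | qs 1 (2 * x + 1) = M} = {(S - 1) / 2, (-S - 1) / 2} := by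
        ext x
        simp only [Set.mem_ofPred_eq, Set.mem_insert_iff, Set.mem_singleton_iff]
        rw [q1, h3, sq_eq_sq_iff_eq_or_eq_neg]
        omega
      rw [this, Set.ncard_pair (by omega)]; rfl
    have c2 : coeff M JJ = c4 S * S := by
      rw [JJ, coeff_G]
      have : {x : ℤ | qs 1 (4 * x + 1) = M} = {(c4 S * S - 1) / 4} := by
        ext x
        simp only [Set.mem_ofPred_eq, Set.mem_singleton_iff]
        rw [q1, h3, sq_eq_sq_iff_eq_or_eq_neg]
        unfold c4
        split_ifs <;> omega
      rw [this, finsum_mem_singleton]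
      unfold c4
      split_ifs <;> omega
    rw [c1, c2]; linarith
  · have h4 := II_nsq M (by
      intro S h1 h2 h3
      exact h ⟨S, h1, h2, h3⟩)
    have nz : ∀ x : ℤ, x % 2 = 1 → qs 1 x ≠ M := by
      intro x hx hq
      rw [q1] at hq
      apply h
      rcases lt_or_gt_of_ne (show x ≠ 0 by omega) with h0 | h0
      · exact ⟨-x, by omega, by omega, by rw [← hq]; ring⟩
      · exact ⟨x, h0, hx, hq.symm⟩
    have c1 : coeff M (tho 1) = 0 := coeff_G_zero fun x => nz _ (by omega)
    have c2 : coeff M JJ = 0 := coeff_G_zero fun x => nz _ (by omega)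
    rw [h4, c1, c2]; norm_num

lemma coeff_J2 (n : ℕ) : coeff (4 * n + 7) (JJ * th 2) =
    ∑ᶠ P ∈ {P : ℤ × ℤ | P.1 % 4 = 1 ∧ (4 * n + 7 : ℤ) = P.1 ^ 2 + 2 * P.2 ^ 2}, P.1 := by
  rw [JJ, th, G_mul qJ_FF (qs_FF 2 (by norm_num)), coeff_G]
  refine finsum_mem_eq_of_bijOn (fun p : ℤ × ℤ => (4 * p.1 + 1, p.2)) ?_ ?_
  · have hiff : ∀ x y : ℤ, qs 1 (4 * x + 1) + qs 2 y = 4 * n + 7 ↔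
        (4 * n + 7 : ℤ) = (4 * x + 1) ^ 2 + 2 * y ^ 2 := by
      intro x y
      zify
      rw [qs_cast, qs_cast]
      push_cast
      rw [one_mul, eq_comm]
    refine ⟨?_, ?_, ?_⟩
    · rintro ⟨x, y⟩ h
      exact ⟨by simp only; omega, (hiff x y).1 h⟩
    · rintro ⟨x, y⟩ _ ⟨x', y'⟩ _ h
      simpa using h
    · rintro ⟨u, y⟩ ⟨h1, h2⟩
      simp only at h1 h2
      obtain ⟨x, rfl⟩ : ∃ x, u = 4 * x + 1 := ⟨u / 4, by omega⟩
      exact ⟨(x, y), (hiff x y).2 h2, rfl⟩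
  · rintro ⟨x, y⟩ _
    simp

lemma stepD (n : ℕ) : coeff (4 * n + 7) (tho 1 * tho 2 * (th 4 * ths 4)) =
    (1 - (-1) ^ n) * coeff (4 * n + 7) (JJ * th 2) := by
  have h := th_ths 4 (by norm_num)
  norm_num at h
  have e : tho 1 * tho 2 * (th 4 * ths 4) = (2 : ℤ) • (JJ * tho 2) := by
    rw [h, zsmul_eq_mul]; push_cast
    linear_combination tho 2 * stepII
  have b2 := th_split 2 (by norm_num)
  norm_num at b2
  rw [e, b2, mul_add, map_add, map_zsmul, smul_eq_mul]
  have z : coeff (4 * n + 7) (JJ * th (8 * 1)) = 0 := (Sup_J.mul (Sup_th 8 1)) _ (by omega)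
  norm_num at z
  rw [z, add_zero]
  rcases Nat.even_or_odd n with hn | hn
  · rw [hn.neg_one_pow, (Sup_J.mul (Sup_tho 2)) _ (by obtain ⟨k, rfl⟩ := hn; omega)]
    norm_num
  · rw [hn.neg_one_pow]; norm_num

end final

theorem stmt13 (n : ℕ) (hn : 0 < n) :
    (t 1 1 4 8 n : ℤ) = 2 * (-1) ^ n * (∑ d ∈ (4 * n + 7).divisors, (d : ℤ) * jacobiSym 2 d)
      - (1 - (-1) ^ n) *
        ∑ᶠ P ∈ {P : ℤ × ℤ | P.1 % 4 = 1 ∧ (4 * n + 7 : ℤ) = P.1 ^ 2 + 2 * P.2 ^ 2}, P.1 := by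
  have a1 := tho_sq 1 (by norm_num)
  have b1 := th_split 4 (by norm_num)
  have b2 := ths_split 4 (by norm_num)
  norm_num at a1 b1 b2
  have e1 : (tho 1 * tho 1) * (tho 4 * tho 8) = (2 : ℤ) • ((tho 2 * th 8) * (tho 4 * tho 8)) := by
    rw [a1, zsmul_eq_mul]; push_cast; ring
  have e2 : (2 : ℤ) • ((tho 1 * th 4) * (tho 2 * tho 4)) =
      tho 1 * tho 2 * (th 4 * th 4) - tho 1 * tho 2 * (th 4 * ths 4) := by
    rw [zsmul_eq_mul]; push_cast
    linear_combination tho 1 * tho 2 * th 4 * (b2 - b1)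
  rw [t_coeff, e1, map_zsmul, scale2, ← map_zsmul, e2, map_sub, stepD, coeff_J2,
    stepI _ (by omega), sum_c8 _ (by omega)]
  have hc : c8 ((4 * n + 7 : ℕ) : ℤ) = (-1) ^ n := by
    rcases Nat.even_or_odd n with h | h
    · rw [h.neg_one_pow]; obtain ⟨k, rfl⟩ := h
      unfold c8; rw [if_pos (by omega)]
    · rw [h.neg_one_pow]; obtain ⟨k, rfl⟩ := h
      unfold c8; rw [if_neg (by omega), if_pos (by omega)]
  rw [hc]; ring
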